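/- Assume (A3): dom(f) = S⁺_d and there exists k > 0 with f(A) ≤ k·tr(A) for all A ∈ S⁺_d. Let μ, ν ∈ M₊(X) satisfy the nonconcentration property on ∂X: there exists an open set U ⊂ ℝ^d containing X such that sup { ∫ψ dν − ∫ψ dμ : ψ bounded upper semicontinuous on X, continuous on Ω, and a viscosity supersolution of 1 − 𝒯(½∇²ψ) = 0 in Ω } equals sup { ∫ψ dν − ∫ψ dμ : ψ ∈ C(U) a viscosity supersolution of 1 − 𝒯(½∇²ψ) = 0 in U }. Then F(μ,ν) = H(μ,ν). -/

import Mathlib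

open MeasureTheory Set Filter Topology
open scoped ENNReal NNReal Classical

noncomputable section

/-- Euclidean space `ℝ^d`. -/
abbrev Ed (d : ℕ) := EuclideanSpace ℝ (Fin d)

/-- The space `M_d` of real `d × d` matrices. -/
abbrev Matd (d : ℕ) := Matrix (Fin d) (Fin d) ℝ

/-- The Frobenius inner product `A : B = tr(Aᵀ B)`. -/
def frob {d : ℕ} (A B : Matd d) : ℝ := ∑ i, ∑ j, A i j * B i j

/-- The Frobenius norm of a matrix. -/
def matnorm {d : ℕ} (A : Matd d) : ℝ := Real.sqrt (frob A A)

/-- The Hessian matrix `∇²φ(x)`. -/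
def hess {d : ℕ} (φ : Ed d → ℝ) (x : Ed d) : Matd d :=
  fun i j => iteratedFDeriv ℝ 2 φ x ![EuclideanSpace.single i 1, EuclideanSpace.single j 1]

/-- `φ ∈ C²_c(ℝ^d)`. -/
def IsC2c {d : ℕ} (φ : Ed d → ℝ) : Prop := ContDiff ℝ 2 φ ∧ HasCompactSupport φ

/-- Assumption (A1): `dom f ⊆ S⁺_d`, `f` is coercive and sublinear
(subadditive and positively 1-homogeneous). -/
def CostA1 {d : ℕ} (f : Matd d → ℝ≥0∞) : Prop :=
  (∀ M, f M ≠ ⊤ → M.PosSemidef) ∧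
  (∃ c : ℝ, 0 < c ∧ ∀ M, ENNReal.ofReal (c * matnorm M) ≤ f M) ∧
  (∀ A B, f (A + B) ≤ f A + f B) ∧
  (∀ t : ℝ, 0 ≤ t → ∀ A, f (t • A) = ENNReal.ofReal t * f A)

/-- Assumption (A2): `f` is lower semicontinuous. -/
def CostA2 {d : ℕ} (f : Matd d → ℝ≥0∞) : Prop := LowerSemicontinuous f

/-- `dom(f⋆) = {A | A : M ≤ f(M) for all M ∈ dom f}`. -/
def domFstar {d : ℕ} (f : Matd d → ℝ≥0∞) : Set (Matd d) :=
  { A | ∀ M, f M ≠ ⊤ → ENNReal.ofReal (frob A M) ≤ f M }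

/-- A competitor `λ = ρ·m` (an `S⁺_d`-valued measure supported in `X`) for the static problem:
`tr(½∇²λ) = ν − μ` in the distributional sense. -/
def IsStaticCompetitor {d : ℕ} (X : Set (Ed d)) (μ ν : Measure (Ed d))
    (m : Measure (Ed d)) (ρ : Ed d → Matd d) : Prop :=
  IsFiniteMeasure m ∧ m Xᶜ = 0 ∧ (∀ x, (ρ x).PosSemidef) ∧
    ∀ φ : Ed d → ℝ, IsC2c φ →
      ∫ x, (1/2 : ℝ) * frob (hess φ x) (ρ x) ∂m = ∫ x, φ x ∂ν - ∫ x, φ x ∂μ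

/-- The static value `F(μ,ν)` (using the positive 1-homogeneity of `f`, the cost of
`λ = ρ·m` is `∫ f(dλ/d|λ|) d|λ| = ∫ f(ρ) dm`). -/
def Fstat {d : ℕ} (f : Matd d → ℝ≥0∞) (X : Set (Ed d)) (μ ν : Measure (Ed d)) : ℝ≥0∞ :=
  sInf { c | ∃ m ρ, IsStaticCompetitor X μ ν m ρ ∧ c = ∫⁻ x, f (ρ x) ∂m }

/-- `(ϱ, λ)`, with `ϱ = ϱ_t ⊗ L¹⌞(0,1)` and `λ = (ρ_t · m_t) ⊗ L¹⌞(0,1)` an `S⁺_d`-valued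
measure, solves the Fokker–Planck equation `∂_t ϱ = tr(½∇²λ)` on `(0,1) × ℝ^d`. -/
def SolvesFPE {d : ℕ} (ϱ : ℝ → Measure (Ed d)) (m : ℝ → Measure (Ed d))
    (ρ : ℝ → Ed d → Matd d) : Prop :=
  (∀ t ∈ Ioo (0:ℝ) 1, IsFiniteMeasure (ϱ t) ∧ IsFiniteMeasure (m t)) ∧
  (∀ t ∈ Ioo (0:ℝ) 1, ∀ x, (ρ t x).PosSemidef) ∧
  (∀ A : Set (Ed d), IsCompact A →
    (∫⁻ t in Ioo (0:ℝ) 1, ∫⁻ x in A, ENNReal.ofReal (matnorm (ρ t x)) ∂(m t)) < ⊤) ∧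
  (∀ φ : ℝ × Ed d → ℝ, ContDiff ℝ 2 φ → HasCompactSupport φ →
    tsupport φ ⊆ Ioo (0:ℝ) 1 ×ˢ (univ : Set (Ed d)) →
    (∫ t in Ioo (0:ℝ) 1, ∫ x, fderiv ℝ φ (t, x) (1, 0) ∂(ϱ t)) =
      - ∫ t in Ioo (0:ℝ) 1, ∫ x, (1/2 : ℝ) * frob (hess (fun y => φ (t, y)) x) (ρ t x) ∂(m t))

/-- The support condition (⋆): `supp ϱ_t, supp λ_t ⊆ X` for a.e. `t ∈ (0,1)`. -/
def SuppCond {d : ℕ} (X : Set (Ed d)) (ϱ m : ℝ → Measure (Ed d)) : Prop :=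
  ∀ᵐ t ∂(volume.restrict (Ioo (0:ℝ) 1)), (ϱ t) Xᶜ = 0 ∧ (m t) Xᶜ = 0

/-- `μ` is the weak* (narrow) limit of `ϱ_t` as `t → t₀` within `(0,1)`. -/
def NarrowLim {d : ℕ} (ϱ : ℝ → Measure (Ed d)) (t₀ : ℝ) (μ : Measure (Ed d)) : Prop :=
  ∀ g : BoundedContinuousFunction (Ed d) ℝ,
    Tendsto (fun t => ∫ x, g x ∂(ϱ t)) (𝓝[Ioo (0:ℝ) 1] t₀) (𝓝 (∫ x, g x ∂μ))

/-- The dynamic (Benamou–Brenier type) value `F(μ,ν)`. -/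
def Fdyn {d : ℕ} (f : Matd d → ℝ≥0∞) (X : Set (Ed d)) (μ ν : Measure (Ed d)) : ℝ≥0∞ :=
  sInf { c | ∃ ϱ m ρ, SolvesFPE ϱ m ρ ∧ SuppCond X ϱ m ∧
      NarrowLim ϱ 0 μ ∧ NarrowLim ϱ 1 ν ∧
      c = ∫⁻ t in Ioo (0:ℝ) 1, ∫⁻ x, f (ρ t x) ∂(m t) }

/-- the cost `G(x,p) := F(δ_x, p)`. -/
def Gcost {d : ℕ} (f : Matd d → ℝ≥0∞) (X : Set (Ed d)) (x : Ed d)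
    (p : Measure (Ed d)) : ℝ≥0∞ :=
  Fstat f X (Measure.dirac x) p

/-- A disintegration kernel `x ↦ γ^x` of a transport plan `γ ∈ Π(μ,ν)`. -/
def IsTransportKernel {d : ℕ} (X : Set (Ed d)) (μ ν : Measure (Ed d))
    (κ : Ed d → Measure (Ed d)) : Prop :=
  (∀ x, IsProbabilityMeasure (κ x) ∧ (κ x) Xᶜ = 0) ∧
  (∀ A : Set (Ed d), MeasurableSet A → Measurable fun x => κ x A) ∧
  (∀ A : Set (Ed d), MeasurableSet A → ∫⁻ x, κ x A ∂μ = ν A)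

/-- The static optimal transport value `H(μ,ν) = inf_{γ ∈ Π(μ,ν)} ∫ G(x,γ^x) dμ`. -/
def Hcost {d : ℕ} (f : Matd d → ℝ≥0∞) (X : Set (Ed d)) (μ ν : Measure (Ed d)) : ℝ≥0∞ :=
  sInf { c | ∃ κ, IsTransportKernel X μ ν κ ∧ c = ∫⁻ x, Gcost f X x (κ x) ∂μ }

/-- Integral of `φ` against a signed measure. -/
def sInt {d : ℕ} (s : SignedMeasure (Ed d)) (φ : Ed d → ℝ) : ℝ :=
  ∫ x, φ x ∂s.toJordanDecomposition.posPart - ∫ x, φ x ∂s.toJordanDecomposition.negPart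

/-- A signed measure is supported in `X`. -/
def SuppInX {d : ℕ} (X : Set (Ed d)) (s : SignedMeasure (Ed d)) : Prop :=
  ∀ A : Set (Ed d), MeasurableSet A → A ⊆ Xᶜ → s A = 0

/-- The extension of `F` to signed measures: `+∞` unless `μ, ν ≥ 0` with equal masses. -/
def FSgn {d : ℕ} (f : Matd d → ℝ≥0∞) (X : Set (Ed d)) (μ ν : SignedMeasure (Ed d)) : ℝ≥0∞ :=
  if 0 ≤ μ ∧ 0 ≤ ν ∧ μ univ = ν univ then
    Fstat f X μ.toJordanDecomposition.posPart ν.toJordanDecomposition.posPart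
  else ⊤

/-- The extension of `H` to signed measures: `+∞` unless `μ, ν ≥ 0` with equal masses. -/
def HSgn {d : ℕ} (f : Matd d → ℝ≥0∞) (X : Set (Ed d)) (μ ν : SignedMeasure (Ed d)) : ℝ≥0∞ :=
  if 0 ≤ μ ∧ 0 ≤ ν ∧ μ univ = ν univ then
    Hcost f X μ.toJordanDecomposition.posPart ν.toJordanDecomposition.posPart
  else ⊤

/-- The weak* topology on signed measures, in duality with continuous functions. -/
def weakStarTop (d : ℕ) : TopologicalSpace (SignedMeasure (Ed d)) :=
  ⨅ g : C(Ed d, ℝ), TopologicalSpace.induced (fun s => sInt s g) inferInstance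

/-- The `G`-transform `φ^G(x) = inf { ∫ φ dp + G(x,p) : p ∈ P(X) }`. -/
def GTrans {d : ℕ} (f : Matd d → ℝ≥0∞) (X : Set (Ed d)) (φ : Ed d → ℝ) (x : Ed d) : EReal :=
  sInf { c : EReal | ∃ p : Measure (Ed d), IsProbabilityMeasure p ∧ p Xᶜ = 0 ∧
      c = ((∫ y, φ y ∂p : ℝ) : EReal) + (Gcost f X x p : EReal) }

/-- `φ = φ^G` on `E`. -/
def GEq {d : ℕ} (f : Matd d → ℝ≥0∞) (X : Set (Ed d)) (φ : Ed d → ℝ) (E : Set (Ed d)) : Prop :=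
  ∀ x ∈ E, GTrans f X φ x = ((φ x : ℝ) : EReal)

/-- `𝒯(A) = sup { A : M | M ∈ S⁺⁺_d, f(M) = 1 }`. -/
def Tcal {d : ℕ} (f : Matd d → ℝ≥0∞) (A : Matd d) : EReal :=
  sSup { c : EReal | ∃ M : Matd d, M.PosDef ∧ f M = 1 ∧ c = ((frob A M : ℝ) : EReal) }

/-- `u` is a viscosity supersolution of `c − 𝒯(½∇²u) = 0` in `U`. -/
def IsViscSupersol {d : ℕ} (f : Matd d → ℝ≥0∞) (c : ℝ) (u : Ed d → ℝ) (U : Set (Ed d)) : Prop :=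
  ∀ φ : Ed d → ℝ, ContDiffOn ℝ 2 φ U → ∀ x ∈ U,
    IsLocalMinOn (fun y => u y - φ y) U x →
    Tcal f ((1/2 : ℝ) • hess φ x) ≤ ((c : ℝ) : EReal)

/-- Integral of an `EReal`-valued function against a measure
(positive part minus negative part). -/
def erealInt {d : ℕ} (m : Measure (Ed d)) (u : Ed d → EReal) : EReal :=
  ((∫⁻ y, ENNReal.ofReal ((u y).toReal) ∂m : ℝ≥0∞) : EReal) -
    ((∫⁻ y, (if u y = ⊥ then (⊤ : ℝ≥0∞) else ENNReal.ofReal (-(u y).toReal)) ∂m : ℝ≥0∞) : EReal)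

/-- `u : U → ℝ ∪ {−∞}` is subharmonic on the open set `U`: it is upper semicontinuous,
not identically `−∞` on any connected component, and satisfies the sub-mean value
inequality on spheres. -/
def Subharmonic {d : ℕ} (U : Set (Ed d)) (u : Ed d → EReal) : Prop :=
  (∀ x, u x ≠ ⊤) ∧
  (∀ x ∈ U, ∃ y ∈ connectedComponentIn U x, u y ≠ ⊥) ∧
  UpperSemicontinuousOn u U ∧
  (∀ x ∈ U, ∀ r : ℝ, 0 < r → Metric.closedBall x r ⊆ U →
    (((μH[(d : ℝ) - 1] (Metric.sphere x r)).toReal : ℝ) : EReal) * u x ≤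
      erealInt ((μH[(d : ℝ) - 1]).restrict (Metric.sphere x r)) u)

/-- The (topological) support of a measure. -/
def msupp {d : ℕ} (m : Measure (Ed d)) : Set (Ed d) :=
  { x | ∀ U : Set (Ed d), IsOpen U → x ∈ U → m U ≠ 0 }

/-- `m₁ ≤_SH m₂`: subharmonic order. -/
def SHOrder {d : ℕ} (m₁ m₂ : Measure (Ed d)) : Prop :=
  ∀ U : Set (Ed d), IsOpen U → msupp (m₁ + m₂) ⊆ U →
    ∀ u : Ed d → EReal, Subharmonic U u →
      erealInt (m₁.restrict U) u ≤ erealInt (m₂.restrict U) u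

/-- The second moment matrix `∫ x ⊗ x dκ`. -/
def secondMoment {d : ℕ} (κ : Measure (Ed d)) : Matd d :=
  fun i j => ∫ x, x i * x j ∂κ

end

open MeasureTheory Set Filter Topology
open scoped ENNReal NNReal Classical

/-- Hahn-Banach + Riesz-Markov-Kakutani. -/
theorem hb_rmk {Y : Type*} [TopologicalSpace Y] [CompactSpace Y] [T2Space Y] [MeasurableSpace Y]
    [BorelSpace Y] {V : Type*} [AddCommGroup V] [Module ℝ V]
    (T : V →ₗ[ℝ] C(Y, ℝ)) (ℓ : V →ₗ[ℝ] ℝ) (D : ℝ) (hD : 0 ≤ D)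
    (h : ∀ v, (∀ y, T v y ≤ 1) → ℓ v ≤ D) :
    ∃ θ : Measure Y, IsFiniteMeasure θ ∧ θ.real univ ≤ D ∧ ∀ v, ℓ v = ∫ y, T v y ∂θ := by
  have hz : ∀ v, (∀ y, T v y ≤ 0) → ℓ v ≤ 0 := by
    intro v hv
    by_contra hc
    push Not at hc
    have h1 := h (((D + 1) / ℓ v) • v) (fun y => by
      have : 0 ≤ (D + 1) / ℓ v := by positivity
      simp only [map_smul, ContinuousMap.smul_apply, smul_eq_mul]
      nlinarith [hv y])
    simp only [map_smul, smul_eq_mul] at h1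
    rw [div_mul_cancel₀ _ hc.ne'] at h1
    linarith
  have hker : LinearMap.ker T ≤ LinearMap.ker ℓ := by
    intro v hv
    rw [LinearMap.mem_ker] at hv ⊢
    have h1 := hz v (by simp [hv])
    have h2 := hz (-v) (by simp [hv])
    simp only [map_neg] at h2
    linarith
  let ℓ' : LinearMap.range T →ₗ[ℝ] ℝ :=
    ((LinearMap.ker T).liftQ ℓ hker).comp (T.quotKerEquivRange.symm : _ →ₗ[ℝ] _)
  have hℓ' : ∀ v (hv : T v ∈ LinearMap.range T), ℓ' ⟨T v, hv⟩ = ℓ v := by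
    intro v hv
    have : T.quotKerEquivRange.symm ⟨T v, hv⟩ = Submodule.Quotient.mk v := by
      rw [LinearEquiv.symm_apply_eq]
      ext1
      simp [LinearMap.quotKerEquivRange_apply_mk]
    change ((LinearMap.ker T).liftQ ℓ hker) (T.quotKerEquivRange.symm ⟨T v, hv⟩) = _
    rw [this]
    exact (LinearMap.ker T).liftQ_apply ℓ v
  have hmaj : ∀ (g : C(Y, ℝ)) y, g y ≤ ‖g ⊔ 0‖ := by
    intro g y
    have := ContinuousMap.norm_coe_le_norm (g ⊔ 0) y
    refine le_trans ?_ this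
    simp only [ContinuousMap.sup_apply, ContinuousMap.zero_apply, Real.norm_eq_abs]
    exact (le_max_left _ _).trans (le_abs_self _)
  obtain ⟨Λ, hΛ1, hΛ2⟩ := exists_extension_of_le_sublinear (⟨LinearMap.range T, ℓ'⟩ : C(Y, ℝ) →ₗ.[ℝ] ℝ)
    (fun g => D * ‖g ⊔ 0‖) (by
      intro c hc x
      have : (c • x) ⊔ 0 = c • (x ⊔ 0) := by
        ext y
        simp only [ContinuousMap.sup_apply, ContinuousMap.smul_apply, ContinuousMap.zero_apply,
          smul_eq_mul]
        rw [mul_max_of_nonneg _ _ hc.le, mul_zero]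
      simp only [this, norm_smul, Real.norm_eq_abs, abs_of_pos hc]
      ring) (by
      intro x y
      rw [← mul_add]
      refine mul_le_mul_of_nonneg_left ?_ hD
      refine (ContinuousMap.norm_le _ (by positivity)).2 ?_
      intro z
      simp only [ContinuousMap.sup_apply, ContinuousMap.zero_apply, ContinuousMap.add_apply,
        Real.norm_eq_abs]
      rw [abs_of_nonneg (le_max_right _ _)]
      have h1 := hmaj x z
      have h2 := hmaj y z
      exact max_le (by linarith) (by positivity)) (by
      rintro ⟨_, v, rfl⟩
      refine (hℓ' v (LinearMap.mem_range_self T v)).le.trans ?_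
      change _ ≤ D * ‖T v ⊔ 0‖
      rcases (norm_nonneg (T v ⊔ 0)).eq_or_lt with h0 | h0
      · rw [← h0, mul_zero]
        exact hz v (fun y => by rw [h0]; exact hmaj _ _)
      · have h1 := h ((‖T v ⊔ 0‖)⁻¹ • v) (fun y => by
          simp only [map_smul, ContinuousMap.smul_apply, smul_eq_mul]
          rw [inv_mul_le_iff₀ h0, mul_one]; exact hmaj _ _)
        simp only [map_smul, smul_eq_mul] at h1
        rw [inv_mul_le_iff₀ h0] at h1
        linarith)
  have hpos : ∀ g : C(Y, ℝ), (∀ y, 0 ≤ g y) → 0 ≤ Λ g := by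
    intro g hg
    have h1 := hΛ2 (-g)
    have : (-g) ⊔ 0 = 0 := by
      ext y
      simp [hg y]
    simp only [this, map_neg, norm_zero, mul_zero] at h1
    linarith
  let Λc : CompactlySupportedContinuousMap Y ℝ →ₗ[ℝ] ℝ :=
    { toFun := fun g => Λ g.toContinuousMap
      map_add' := fun a b => by rw [← map_add]; rfl
      map_smul' := fun a b => by rw [RingHom.id_apply, ← map_smul]; rfl }
  let Λp : CompactlySupportedContinuousMap Y ℝ →ₚ[ℝ] ℝ := PositiveLinearMap.mk₀ Λc (by
    intro g hg
    exact hpos _ (fun y => hg y))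
  have hint : ∀ g : C(Y, ℝ), ∫ y, g y ∂(RealRMK.rieszMeasure Λp) = Λ g := by
    intro g
    have := RealRMK.integral_rieszMeasure Λp ⟨g, HasCompactSupport.of_compactSpace _⟩
    exact this
  have hfin : IsFiniteMeasure (RealRMK.rieszMeasure Λp) := ⟨isCompact_univ.measure_lt_top⟩
  refine ⟨RealRMK.rieszMeasure Λp, hfin, ?_, ?_⟩
  · have h1 := hint 1
    simp only [ContinuousMap.one_apply, integral_const, smul_eq_mul, mul_one] at h1
    rw [h1]
    refine (hΛ2 1).trans ?_
    have : ‖(1 : C(Y, ℝ)) ⊔ 0‖ ≤ 1 := by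
      refine (ContinuousMap.norm_le _ zero_le_one).2 ?_
      intro z; simp
    nlinarith
  · intro v
    rw [hint]
    have := hΛ1 ⟨T v, LinearMap.mem_range_self T v⟩
    rw [this]
    exact (hℓ' v _).symm

open MeasureTheory Set Filter Topology
open scoped ENNReal NNReal Classical

/-- unit ball of `f`. -/
def Kset {d : ℕ} (f : Matd d → ℝ≥0∞) : Set (Fin d → Fin d → ℝ) :=
  {M | f (Matrix.of M) ≤ 1}

/-- the vector space of `C²_c` functions. -/
def C2c (d : ℕ) : Submodule ℝ (Ed d → ℝ) where
  carrier := {φ | IsC2c φ}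
  add_mem' := fun ha hb => ⟨ha.1.add hb.1, ha.2.add hb.2⟩
  zero_mem' := ⟨contDiff_const, HasCompactSupport.zero⟩
  smul_mem' := fun c _ ha => ⟨contDiff_const.smul ha.1, ha.2.smul_left (f := fun _ => c)⟩

/-- dual admissible functions -/
def Adm {d : ℕ} (f : Matd d → ℝ≥0∞) (X : Set (Ed d)) (g : Ed d → ℝ) : Prop :=
  IsC2c g ∧ ∀ x ∈ X, ∀ M ∈ Kset f, (1/2 : ℝ) * frob (hess g x) M ≤ 1

section basics
variable {d : ℕ}

theorem frob_add_left (A B M : Matd d) : frob (A + B) M = frob A M + frob B M := by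
  simp [frob, add_mul, Finset.sum_add_distrib]

theorem frob_smul_left (c : ℝ) (A M : Matd d) : frob (c • A) M = c * frob A M := by
  simp [frob, Finset.mul_sum, mul_assoc]

theorem frob_add_right (A B M : Matd d) : frob M (A + B) = frob M A + frob M B := by
  simp [frob, mul_add, Finset.sum_add_distrib]

theorem frob_smul_right (c : ℝ) (A M : Matd d) : frob M (c • A) = c * frob M A := by
  simp only [frob, Finset.mul_sum, Matrix.smul_apply, smul_eq_mul]
  refine Finset.sum_congr rfl fun i _ => Finset.sum_congr rfl fun j _ => by ring

theorem hess_add {φ ψ : Ed d → ℝ} {x : Ed d} (h1 : ContDiffAt ℝ 2 φ x) (h2 : ContDiffAt ℝ 2 ψ x) :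
    hess (φ + ψ) x = hess φ x + hess ψ x := by
  ext i j
  simp only [hess, Matrix.add_apply]
  rw [iteratedFDeriv_add_apply h1 h2]
  rfl

theorem hess_smul {φ : Ed d → ℝ} {x : Ed d} (c : ℝ) (h1 : ContDiffAt ℝ 2 φ x) :
    hess (c • φ) x = c • hess φ x := by
  ext i j
  simp only [hess, Matrix.smul_apply]
  rw [iteratedFDeriv_const_smul_apply h1]
  rfl

theorem hess_congr {φ ψ : Ed d → ℝ} {x : Ed d} (h : φ =ᶠ[𝓝 x] ψ) : hess φ x = hess ψ x := by
  ext i j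
  simp only [hess]
  rw [(Filter.EventuallyEq.iteratedFDeriv ℝ h 2).eq_of_nhds]

theorem hess_quad (φ : Ed d → ℝ) (x v : Ed d) :
    frob (hess φ x) (Matrix.vecMulVec v v) = iteratedFDeriv ℝ 2 φ x ![v, v] := by
  have hv : v = ∑ i, v i • EuclideanSpace.single i (1 : ℝ) := by
    have := (EuclideanSpace.basisFun (Fin d) ℝ).sum_repr v
    simpa using this.symm
  rw [iteratedFDeriv_two_apply]
  simp only [Matrix.cons_val_zero, Matrix.cons_val_one, frob, hess, Matrix.vecMulVec_apply]
  conv_rhs => rw [hv]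
  simp only [map_sum, map_smul, sum_apply, smul_apply,
    smul_eq_mul, iteratedFDeriv_two_apply, Matrix.cons_val_zero, Matrix.cons_val_one,
    Finset.mul_sum]
  rw [Finset.sum_comm]
  exact Finset.sum_congr rfl fun i _ => Finset.sum_congr rfl fun j _ => by ring

theorem hess_continuous {φ : Ed d → ℝ} (h : ContDiff ℝ 2 φ) (i j : Fin d) :
    Continuous fun x => hess φ x i j := by
  unfold hess
  have h1 := h.continuous_iteratedFDeriv (m := 2) le_rfl
  exact (ContinuousMultilinearMap.apply ℝ (fun _ : Fin 2 => Ed d) ℝ _).continuous.comp h1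

theorem hess_compact {φ : Ed d → ℝ} (h : HasCompactSupport φ) (i j : Fin d) :
    HasCompactSupport fun x => hess φ x i j := by
  unfold hess
  have h1 := h.iteratedFDeriv (𝕜 := ℝ) 2
  exact h1.comp_left (g := fun (L : ContinuousMultilinearMap ℝ (fun _ : Fin 2 => Ed d) ℝ) =>
    L ![EuclideanSpace.single i 1, EuclideanSpace.single j 1]) (by simp)

theorem f_zero {f : Matd d → ℝ≥0∞} (hA1 : CostA1 f) : f 0 = 0 := by
  have := hA1.2.2.2 0 le_rfl 0
  simpa using this

theorem abs_le_matnorm (M : Matd d) (i j : Fin d) : |M i j| ≤ matnorm M := by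
  unfold matnorm
  apply Real.abs_le_sqrt
  unfold frob
  have h1 : M i j ^ 2 ≤ ∑ j, M i j * M i j := by
    rw [pow_two]
    exact Finset.single_le_sum (f := fun j => M i j * M i j) (fun j _ => mul_self_nonneg _)
      (Finset.mem_univ j)
  refine h1.trans ?_
  exact Finset.single_le_sum (f := fun i => ∑ j, M i j * M i j)
    (fun i _ => Finset.sum_nonneg fun j _ => mul_self_nonneg _) (Finset.mem_univ i)

theorem Kset_bound {f : Matd d → ℝ≥0∞} (hA1 : CostA1 f) :
    ∃ C : ℝ, 0 ≤ C ∧ ∀ M ∈ Kset f, ∀ i j, |M i j| ≤ C := by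
  obtain ⟨c, hc, h⟩ := hA1.2.1
  refine ⟨1 / c, by positivity, fun M hM i j => ?_⟩
  have h1 := (h (Matrix.of M)).trans hM
  rw [ENNReal.ofReal_le_one] at h1
  rw [le_div_iff₀ hc]
  have := abs_le_matnorm (Matrix.of M) i j
  simp only [Matrix.of_apply] at this
  nlinarith

theorem Kset_closed {f : Matd d → ℝ≥0∞} (hA2 : CostA2 f) : IsClosed (Kset f) := by
  have h : LowerSemicontinuous f := hA2
  exact h.isClosed_preimage 1

theorem Kset_compact {f : Matd d → ℝ≥0∞} (hA1 : CostA1 f) (hA2 : CostA2 f) :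
    IsCompact (Kset f) := by
  refine Metric.isCompact_of_isClosed_isBounded (Kset_closed hA2) ?_
  obtain ⟨C, hC0, hC⟩ := Kset_bound hA1
  refine (Metric.isBounded_iff_subset_closedBall 0).2 ⟨C, fun M hM => ?_⟩
  rw [mem_closedBall_zero_iff]
  exact (pi_norm_le_iff_of_nonneg hC0).2 fun i => (pi_norm_le_iff_of_nonneg hC0).2 fun j => hC M hM i j

theorem Kset_zero {f : Matd d → ℝ≥0∞} (hA1 : CostA1 f) : (0 : Fin d → Fin d → ℝ) ∈ Kset f := by
  change f 0 ≤ 1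
  rw [f_zero hA1]; exact zero_le_one

theorem Kset_convex {f : Matd d → ℝ≥0∞} (hA1 : CostA1 f) : Convex ℝ (Kset f) := by
  intro M hM N hN a b ha hb hab
  change f (a • Matrix.of M + b • Matrix.of N) ≤ 1
  refine (hA1.2.2.1 _ _).trans ?_
  rw [hA1.2.2.2 a ha, hA1.2.2.2 b hb]
  calc _ ≤ ENNReal.ofReal a * 1 + ENNReal.ofReal b * 1 := by gcongr <;> assumption
    _ = 1 := by rw [mul_one, mul_one, ← ENNReal.ofReal_add ha hb, hab, ENNReal.ofReal_one]

theorem Kset_psd {f : Matd d → ℝ≥0∞} (hA1 : CostA1 f) {M} (hM : M ∈ Kset f) :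
    (Matrix.of M).PosSemidef :=
  hA1.1 _ (ne_top_of_le_ne_top ENNReal.one_ne_top hM)

theorem adm_scale {f : Matd d → ℝ≥0∞} (hA1 : CostA1 f) (A : Matd d)
    (h : ∀ M ∈ Kset f, frob A M ≤ 1) (M : Matd d) :
    ENNReal.ofReal (frob A M) ≤ f M := by
  by_cases ht : f M = ⊤
  · rw [ht]; exact le_top
  rcases eq_or_ne (f M) 0 with h0 | h0
  · have hM : M = 0 := by
      obtain ⟨c, hc, hh⟩ := hA1.2.1
      have h1 := hh M
      rw [h0, nonpos_iff_eq_zero, ENNReal.ofReal_eq_zero] at h1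
      ext i j
      have h2 := abs_le_matnorm M i j
      have h3 : |M i j| ≤ 0 := by nlinarith
      simpa using h3
    rw [hM]; simp [frob]
  · have hp : 0 < (f M).toReal := ENNReal.toReal_pos h0 ht
    have h1 : ((f M).toReal⁻¹ • M : Matd d) ∈ Kset f := by
      change f ((f M).toReal⁻¹ • M) ≤ 1
      rw [hA1.2.2.2 _ (by positivity), ENNReal.ofReal_inv_of_pos hp, ENNReal.ofReal_toReal ht,
        ENNReal.inv_mul_cancel h0 ht]
    have h2 := h _ h1
    rw [frob_smul_right, inv_mul_le_iff₀ hp, mul_one] at h2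
    rw [← ENNReal.ofReal_toReal ht]
    exact ENNReal.ofReal_le_ofReal h2

theorem ofReal_integral_le {α : Type*} [MeasurableSpace α] (m : Measure α) (h : α → ℝ) :
    ENNReal.ofReal (∫ x, h x ∂m) ≤ ∫⁻ x, ENNReal.ofReal (h x) ∂m := by
  by_cases hi : Integrable h m
  · have h1 : ∫ x, h x ∂m ≤ ∫ x, max (h x) 0 ∂m :=
      integral_mono hi hi.pos_part (fun x => le_max_left _ _)
    refine (ENNReal.ofReal_le_ofReal h1).trans ?_
    rw [ofReal_integral_eq_lintegral_ofReal hi.pos_part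
      (Eventually.of_forall fun x => le_max_right _ _)]
    refine lintegral_mono fun x => ?_
    simp
  · rw [integral_undef hi]; simp

theorem ae_mem_X {X : Set (Ed d)} {μ : Measure (Ed d)} (h : μ Xᶜ = 0) : ∀ᵐ x ∂μ, x ∈ X := h

theorem weak_duality {f : Matd d → ℝ≥0∞} (hA1 : CostA1 f) {X : Set (Ed d)}
    {μ ν : Measure (Ed d)} {g : Ed d → ℝ} (hg : Adm f X g) :
    ENNReal.ofReal (∫ x, g x ∂ν - ∫ x, g x ∂μ) ≤ Fstat f X μ ν := by
  refine le_sInf ?_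
  rintro c ⟨m, ρ, ⟨_, hX, _, heq⟩, rfl⟩
  rw [← heq g hg.1]
  refine (ofReal_integral_le _ _).trans (lintegral_mono_ae ?_)
  filter_upwards [ae_mem_X hX] with x hx
  have := adm_scale hA1 ((1/2 : ℝ) • hess g x) (fun M hM =>
    (frob_smul_left _ _ M).le.trans (hg.2 x hx M hM)) (ρ x)
  rwa [frob_smul_left] at this

theorem integrable_C2c {φ : Ed d → ℝ} (h : IsC2c φ) (μ : Measure (Ed d)) [IsFiniteMeasure μ] :
    Integrable φ μ := h.1.continuous.integrable_of_hasCompactSupport h.2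

theorem continuous_frobhess {φ : Ed d → ℝ} (h : ContDiff ℝ 2 φ) {f : Matd d → ℝ≥0∞} :
    Continuous fun p : Ed d × Kset f => (1/2 : ℝ) * frob (hess φ p.1) p.2.1 := by
  unfold frob
  refine continuous_const.mul ?_
  refine continuous_finsetSum _ fun i _ => continuous_finsetSum _ fun j _ => ?_
  refine ((hess_continuous h i j).comp continuous_fst).mul ?_
  have : Continuous fun p : Ed d × Kset f => p.2.1 := continuous_subtype_val.comp continuous_snd
  exact (continuous_apply j).comp ((continuous_apply i).comp this)

theorem bounded_frobhess {φ : Ed d → ℝ} (h : IsC2c φ) {f : Matd d → ℝ≥0∞} (hA1 : CostA1 f) :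
    ∃ C, ∀ (x : Ed d) (M : Kset f), |(1/2 : ℝ) * frob (hess φ x) M.1| ≤ C := by
  obtain ⟨C, hC0, hC⟩ := Kset_bound hA1
  have : ∀ i j, ∃ B, ∀ x, ‖hess φ x i j‖ ≤ B := fun i j =>
    (hess_compact h.2 i j).exists_bound_of_continuous (hess_continuous h.1 i j)
  choose B hB using this
  refine ⟨(1/2) * ∑ i, ∑ j, B i j * C, fun x M => ?_⟩
  rw [abs_mul, abs_of_pos (by norm_num : (0:ℝ) < 1/2)]
  refine mul_le_mul_of_nonneg_left ?_ (by norm_num)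
  unfold frob
  refine (Finset.abs_sum_le_sum_abs _ _).trans (Finset.sum_le_sum fun i _ => ?_)
  refine (Finset.abs_sum_le_sum_abs _ _).trans (Finset.sum_le_sum fun j _ => ?_)
  rw [abs_mul]
  have h1 := hB i j x
  rw [Real.norm_eq_abs] at h1
  exact mul_le_mul h1 (hC _ M.2 i j) (abs_nonneg _) ((abs_nonneg _).trans h1)

theorem integrable_frobhess {φ : Ed d → ℝ} (h : IsC2c φ) {f : Matd d → ℝ≥0∞} (hA1 : CostA1 f)
    (θ : Measure (Ed d × Kset f)) [IsFiniteMeasure θ] :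
    Integrable (fun p : Ed d × Kset f => (1/2 : ℝ) * frob (hess φ p.1) p.2.1) θ := by
  obtain ⟨C, hC⟩ := bounded_frobhess h hA1
  exact Integrable.of_bound (continuous_frobhess h.1).aestronglyMeasurable C
    (Eventually.of_forall fun p => hC p.1 p.2)

theorem Fstat_le_of_theta {f : Matd d → ℝ≥0∞} (hA1 : CostA1 f) (hA2 : CostA2 f)
    {X : Set (Ed d)} (hX : MeasurableSet X) {μ ν : Measure (Ed d)}
    (θ : Measure (Ed d × Kset f)) [IsFiniteMeasure θ] (hθX : θ (Prod.fst ⁻¹' Xᶜ) = 0)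
    (hθ : ∀ φ, IsC2c φ → ∫ p, (1/2 : ℝ) * frob (hess φ p.1) p.2.1 ∂θ =
      ∫ x, φ x ∂ν - ∫ x, φ x ∂μ) : Fstat f X μ ν ≤ θ univ := by
  have : Nonempty (Kset f) := ⟨⟨0, Kset_zero hA1⟩⟩
  have : StandardBorelSpace (Kset f) := (Kset_closed hA2).measurableSet.standardBorel
  obtain ⟨C, hC0, hC⟩ := Kset_bound hA1
  have hint : ∀ x, Integrable (fun M : Kset f => M.1) (θ.condKernel x) := fun x =>
    Integrable.of_bound continuous_subtype_val.aestronglyMeasurable C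
      (Eventually.of_forall fun M => (pi_norm_le_iff_of_nonneg hC0).2 fun i =>
        (pi_norm_le_iff_of_nonneg hC0).2 fun j => hC M.1 M.2 i j)
  let ρ : Ed d → Fin d → Fin d → ℝ := fun x => ∫ M : Kset f, M.1 ∂(θ.condKernel x)
  have hρK : ∀ x, ρ x ∈ Kset f := fun x =>
    (Kset_convex hA1).integral_mem (Kset_closed hA2) (Eventually.of_forall fun M => M.2) (hint x)
  have hcomp : IsStaticCompetitor X μ ν θ.fst ρ := by
    refine ⟨inferInstance, ?_, fun x => Kset_psd hA1 (hρK x), fun φ hφ => ?_⟩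
    · rw [Measure.fst_apply hX.compl]; exact hθX
    · rw [← hθ φ hφ, ← Measure.integral_condKernel (integrable_frobhess hφ hA1 θ)]
      refine integral_congr_ae (Eventually.of_forall fun x => ?_)
      simp only
      let L : (Fin d → Fin d → ℝ) →ₗ[ℝ] ℝ :=
        { toFun := fun M => (1/2 : ℝ) * frob (hess φ x) M
          map_add' := fun A B => by
            have := frob_add_right A B (hess φ x)
            rw [← mul_add]; exact congrArg _ this
          map_smul' := fun c A => by
            have := frob_smul_right c A (hess φ x)
            rw [RingHom.id_apply, smul_eq_mul, mul_left_comm, ← this]; rfl }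
      exact ((LinearMap.toContinuousLinearMap L).integral_comp_comm (hint x)).symm
  have hle : Fstat f X μ ν ≤ ∫⁻ x, f (ρ x) ∂θ.fst := sInf_le ⟨θ.fst, ρ, hcomp, rfl⟩
  refine hle.trans ?_
  calc ∫⁻ x, f (ρ x) ∂θ.fst ≤ ∫⁻ x, 1 ∂θ.fst := lintegral_mono fun x => hρK x
    _ = θ univ := by rw [lintegral_one, Measure.fst_univ]

end basics

open MeasureTheory Set Filter Topology
open scoped ENNReal NNReal Classical

section partF
variable {d : ℕ}

/-- the linear map `φ ↦ ½ ∇²φ : M` -/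
noncomputable def hessT (f : Matd d → ℝ≥0∞) : C2c d →ₗ[ℝ] C(Ed d × Kset f, ℝ) where
  toFun φ := ⟨fun p => (1/2 : ℝ) * frob (hess φ.1 p.1) p.2.1, continuous_frobhess φ.2.1⟩
  map_add' φ ψ := by
    ext p
    change (1/2 : ℝ) * frob (hess (φ.1 + ψ.1) p.1) p.2.1 = (1/2 : ℝ) * frob (hess φ.1 p.1) p.2.1 +
      (1/2 : ℝ) * frob (hess ψ.1 p.1) p.2.1
    rw [hess_add φ.2.1.contDiffAt ψ.2.1.contDiffAt, ← mul_add]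
    exact congrArg _ (frob_add_left _ _ _)
  map_smul' c φ := by
    ext p
    change (1/2 : ℝ) * frob (hess (c • φ.1) p.1) p.2.1 = c * ((1/2 : ℝ) * frob (hess φ.1 p.1) p.2.1)
    rw [hess_smul c φ.2.1.contDiffAt, mul_left_comm]
    exact congrArg _ (frob_smul_left _ _ _)

theorem hessT_apply (f : Matd d → ℝ≥0∞) (φ : C2c d) (p : Ed d × Kset f) :
    hessT f φ p = (1/2 : ℝ) * frob (hess φ.1 p.1) p.2.1 := rfl

/-- restriction of continuous maps along a continuous map, as a linear map -/
def compL {A B : Type*} [TopologicalSpace A] [TopologicalSpace B] (i : C(A, B)) :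
    C(B, ℝ) →ₗ[ℝ] C(A, ℝ) where
  toFun g := g.comp i
  map_add' _ _ := rfl
  map_smul' _ _ := rfl

/-- integration as linear functional on `C2c` -/
noncomputable def intL (μ : Measure (Ed d)) [IsFiniteMeasure μ] : C2c d →ₗ[ℝ] ℝ where
  toFun φ := ∫ x, φ.1 x ∂μ
  map_add' φ ψ := integral_add (integrable_C2c φ.2 μ) (integrable_C2c ψ.2 μ)
  map_smul' c φ := integral_const_mul c φ.1

theorem Fstat_le_of_bound {f : Matd d → ℝ≥0∞} (hA1 : CostA1 f) (hA2 : CostA2 f)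
    {X : Set (Ed d)} (hX : IsCompact X) {μ ν : Measure (Ed d)} [IsFiniteMeasure μ]
    [IsFiniteMeasure ν] (D : ℝ) (hD : 0 ≤ D)
    (h : ∀ g, Adm f X g → ∫ x, g x ∂ν - ∫ x, g x ∂μ ≤ D) : Fstat f X μ ν ≤ ENNReal.ofReal D := by
  have : CompactSpace X := isCompact_iff_compactSpace.1 hX
  have : CompactSpace (Kset f) := isCompact_iff_compactSpace.1 (Kset_compact hA1 hA2)
  let i : C(X × Kset f, Ed d × Kset f) := ⟨Prod.map Subtype.val id, by fun_prop⟩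
  obtain ⟨θ, hfin, hmass, hθ⟩ := hb_rmk ((compL i).comp (hessT f)) (intL ν - intL μ) D hD (by
    intro φ hφ
    exact h φ.1 ⟨φ.2, fun x hx M hM => hφ (⟨x, hx⟩, ⟨M, hM⟩)⟩)
  have him : Measurable i := i.continuous.measurable
  have hle := Fstat_le_of_theta hA1 hA2 hX.measurableSet (μ := μ) (ν := ν) (θ.map i) (by
    rw [Measure.map_apply him (measurable_fst hX.measurableSet.compl)]
    convert measure_empty (μ := θ)
    ext ⟨x, M⟩
    simp [i]) (by
    intro φ hφ
    rw [integral_map him.aemeasurable (continuous_frobhess hφ.1).aestronglyMeasurable]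
    exact (hθ ⟨φ, hφ⟩).symm)
  refine hle.trans ?_
  rw [Measure.map_apply him MeasurableSet.univ, preimage_univ, ← ofReal_measureReal]
  exact ENNReal.ofReal_le_ofReal hmass

theorem F_le_H {f : Matd d → ℝ≥0∞} (hA1 : CostA1 f) (hA2 : CostA2 f)
    {X : Set (Ed d)} (hX : IsCompact X) {μ ν : Measure (Ed d)} [IsFiniteMeasure μ]
    [IsFiniteMeasure ν] : Fstat f X μ ν ≤ Hcost f X μ ν := by
  refine le_sInf ?_
  rintro c ⟨κ, ⟨hκ1, hκ2, hκ3⟩, rfl⟩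
  set c := ∫⁻ x, Gcost f X x (κ x) ∂μ with hc
  by_cases ht : c = ⊤
  · rw [ht]; exact le_top
  rw [← ENNReal.ofReal_toReal ht]
  refine Fstat_le_of_bound hA1 hA2 hX _ ENNReal.toReal_nonneg ?_
  intro g hg
  have hprob : ∀ x, IsProbabilityMeasure (κ x) := fun x => (hκ1 x).1
  let k : ProbabilityTheory.Kernel (Ed d) (Ed d) := ⟨κ, Measure.measurable_of_measurable_coe _ hκ2⟩
  have hk : ProbabilityTheory.IsMarkovKernel k := ⟨hprob⟩
  have hν : ν = (μ.compProd k).snd := by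
    ext A hA
    rw [Measure.snd_apply hA, Measure.compProd_apply (measurable_snd hA), ← hκ3 A hA]
    rfl
  have hgi : Integrable (fun p : Ed d × Ed d => g p.2) (μ.compProd k) := by
    obtain ⟨C, hC⟩ := hg.1.2.exists_bound_of_continuous hg.1.1.continuous
    exact Integrable.of_bound (hg.1.1.continuous.comp continuous_snd).aestronglyMeasurable C
      (Eventually.of_forall fun p => hC p.2)
  have h1 : ∫ x, g x ∂ν = ∫ x, ∫ y, g y ∂(κ x) ∂μ := by
    rw [hν, Measure.snd, integral_map measurable_snd.aemeasurable
      hg.1.1.continuous.aestronglyMeasurable, Measure.integral_compProd hgi]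
    rfl
  have hgi2 : Integrable (fun x => ∫ y, g y ∂(κ x)) μ := by
    obtain ⟨C, hC⟩ := hg.1.2.exists_bound_of_continuous hg.1.1.continuous
    refine Integrable.of_bound (C := C)
      (hg.1.1.continuous.stronglyMeasurable.integral_kernel (κ := k)).aestronglyMeasurable ?_
    refine Eventually.of_forall fun x => ?_
    refine (norm_integral_le_of_norm_le_const (Eventually.of_forall hC)).trans ?_
    have := hprob x
    simp
  rw [h1, ← integral_sub hgi2 (integrable_C2c hg.1 μ)]
  rw [← ENNReal.ofReal_le_iff_le_toReal ht]
  refine (ofReal_integral_le _ _).trans ?_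
  refine lintegral_mono fun x => ?_
  have := weak_duality hA1 (μ := Measure.dirac x) (ν := κ x) hg
  rwa [integral_dirac] at this

end partF

open MeasureTheory Set Filter Topology
open scoped ENNReal NNReal Classical

section partW
variable {d : ℕ}

theorem psd_decomp {M : Matd d} (hM : M.PosSemidef) :
    ∃ v : Fin d → Ed d, M = ∑ k, Matrix.vecMulVec (v k) (v k) := by
  obtain ⟨B, hB⟩ : ∃ B : Matd d, M = B.conjTranspose * B := by
    open scoped MatrixOrder in
    have := hM.nonneg
    exact CStarAlgebra.nonneg_iff_eq_star_mul_self.mp this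
  refine ⟨fun k => WithLp.toLp 2 (B k), ?_⟩
  ext i j
  rw [hB]
  simp [Matrix.mul_apply, Matrix.sum_apply, Matrix.vecMulVec_apply]

/-- second directional derivative -/
noncomputable def D2 (w : Ed d → ℝ) (u x : Ed d) : ℝ := iteratedFDeriv ℝ 2 w x ![u, u]

theorem frob_sum_right {ι : Type*} (s : Finset ι) (A : Matd d) (B : ι → Matd d) :
    frob A (∑ k ∈ s, B k) = ∑ k ∈ s, frob A (B k) := by
  induction s using Finset.induction_on with
  | empty => simp [frob]
  | insert a s ha ih => rw [Finset.sum_insert ha, Finset.sum_insert ha, frob_add_right, ih]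

theorem frob_hess_decomp (w : Ed d → ℝ) (x : Ed d) (v : Fin d → Ed d) :
    frob (hess w x) (∑ k, Matrix.vecMulVec (v k) (v k)) = ∑ k, D2 w (v k) x := by
  rw [frob_sum_right]
  exact Finset.sum_congr rfl fun k _ => hess_quad w x (v k)

theorem D2_smul (w : Ed d → ℝ) (c : ℝ) (u x : Ed d) : D2 w (c • u) x = c ^ 2 * D2 w u x := by
  unfold D2
  rw [iteratedFDeriv_two_apply, iteratedFDeriv_two_apply]
  simp; ring

theorem D2_add {w z : Ed d → ℝ} (hw : ContDiff ℝ 2 w) (hz : ContDiff ℝ 2 z) (u x : Ed d) :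
    D2 (w + z) u x = D2 w u x + D2 z u x := by
  unfold D2
  rw [iteratedFDeriv_add_apply hw.contDiffAt hz.contDiffAt]; rfl

theorem D2_const_smul {w : Ed d → ℝ} (hw : ContDiff ℝ 2 w) (c : ℝ) (u x : Ed d) :
    D2 (c • w) u x = c * D2 w u x := by
  unfold D2
  rw [iteratedFDeriv_const_smul_apply hw.contDiffAt]; rfl

theorem D2_shift (w : Ed d → ℝ) (a u x : Ed d) :
    D2 (fun y => w (y + a)) u x = D2 w u (x + a) := by
  unfold D2
  rw [iteratedFDeriv_comp_add_right]

theorem D2_line {w : Ed d → ℝ} (hw : ContDiff ℝ 2 w) (x u : Ed d) (s : ℝ) :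
    HasDerivAt (fun s : ℝ => w (x + s • u)) (fderiv ℝ w (x + s • u) u) s ∧
    HasDerivAt (fun s : ℝ => fderiv ℝ w (x + s • u) u) (D2 w u (x + s • u)) s := by
  have hl : HasDerivAt (fun s : ℝ => x + s • u) u s := by
    simpa using ((hasDerivAt_id s).smul_const u).const_add x
  constructor
  · have h1 := ((hw.differentiable (by norm_num)) (x + s • u)).hasFDerivAt
    exact h1.comp_hasDerivAt s hl
  · have h2 : DifferentiableAt ℝ (fderiv ℝ w) (x + s • u) :=
      ((hw.fderiv_right (m := 1) (by norm_num)).differentiable (by norm_num)) _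
    have h3 := h2.hasFDerivAt.comp_hasDerivAt s hl
    have h4 := h3.clm_apply (hasDerivAt_const s u)
    simp only [map_zero, add_zero] at h4
    refine h4.congr_deriv ?_
    unfold D2
    rw [iteratedFDeriv_two_apply]
    simp

theorem taylor_sym {w : Ed d → ℝ} (hw : ContDiff ℝ 2 w) (x u : Ed d) {h ε : ℝ} (hh : 0 ≤ h)
    (hε : ∀ s, |s| ≤ h → |D2 w u (x + s • u) - D2 w u x| ≤ ε) :
    |w (x + h • u) + w (x + (-h) • u) - 2 * w x - h ^ 2 * D2 w u x| ≤ 2 * ε * h ^ 2 := by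
  set a := D2 w u x with ha
  have e0 : 0 ≤ ε := (abs_nonneg _).trans (hε 0 (by simpa using hh))
  let p : ℝ → ℝ := fun s => w (x + s • u) + w (x + (-s) • u) - s ^ 2 * a
  let p1 : ℝ → ℝ := fun s => fderiv ℝ w (x + s • u) u - fderiv ℝ w (x + (-s) • u) u - 2 * s * a
  have hp : ∀ s, HasDerivAt p (p1 s) s := by
    intro s
    have h1 := (D2_line hw x u s).1
    have h2 := (D2_line hw x u (-s)).1.scomp s (hasDerivAt_neg s)
    have h3 := (hasDerivAt_pow 2 s).mul_const a
    have := (h1.add h2).sub h3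
    refine this.congr_deriv ?_
    simp only [p1]; simp; ring
  have hp1 : ∀ s, HasDerivAt p1 (D2 w u (x + s • u) + D2 w u (x + (-s) • u) - 2 * a) s := by
    intro s
    have h1 := (D2_line hw x u s).2
    have h2 := (D2_line hw x u (-s)).2.scomp s (hasDerivAt_neg s)
    have h3 := ((hasDerivAt_id s).const_mul 2).mul_const a
    have := (h1.sub h2).sub h3
    refine this.congr_deriv ?_
    simp
  have b1 : ∀ s ∈ Icc (0:ℝ) h, ‖p1 s‖ ≤ 2 * ε * h := by
    intro s hs
    have := (convex_Icc (0:ℝ) h).norm_image_sub_le_of_norm_hasDerivWithin_le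
      (f := p1) (C := 2 * ε) (x := 0) (y := s) (fun t ht => (hp1 t).hasDerivWithinAt) (fun t ht => ?_)
      ⟨le_rfl, hh⟩ hs
    · have h0 : p1 0 = 0 := by simp [p1]
      rw [h0, sub_zero, sub_zero] at this
      refine this.trans ?_
      rw [Real.norm_of_nonneg hs.1]
      gcongr
      exact hs.2
    · have h1 := hε t (by rw [abs_of_nonneg ht.1]; exact ht.2)
      have h2 := hε (-t) (by rw [abs_neg, abs_of_nonneg ht.1]; exact ht.2)
      rw [Real.norm_eq_abs, abs_le]
      rw [abs_le] at h1 h2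
      constructor <;> linarith [h1.1, h1.2, h2.1, h2.2]
  have := (convex_Icc (0:ℝ) h).norm_image_sub_le_of_norm_hasDerivWithin_le
      (f := p) (C := 2 * ε * h) (x := 0) (y := h) (fun t ht => (hp t).hasDerivWithinAt) b1
      ⟨le_rfl, hh⟩ ⟨hh, le_rfl⟩
  have h0 : p 0 = 2 * w x := by simp [p]; ring
  rw [h0, sub_zero, Real.norm_of_nonneg hh] at this
  rw [Real.norm_eq_abs] at this
  convert this using 1
  · simp only [p]; congr 1; ring
  · ring

end partW

open MeasureTheory Set Filter Topology
open scoped ENNReal NNReal Classical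

section partW
variable {d : ℕ}

/-- averaging operator of a random walk step -/
noncomputable def Avg (u : Fin d → Ed d) (h : ℝ) (w : Ed d → ℝ) (x : Ed d) : ℝ :=
  (1 / (2 * (d:ℝ))) * ∑ k, (w (x + h • u k) + w (x + (-h) • u k))

/-- the generator -/
noncomputable def Lop (u : Fin d → Ed d) (w : Ed d → ℝ) (x : Ed d) : ℝ :=
  (1 / (2 * (d:ℝ))) * ∑ k, D2 w (u k) x

/-- modulus of continuity of second derivatives -/
def Modu (u : Fin d → Ed d) (ε δ : ℝ) (w : Ed d → ℝ) : Prop :=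
  ContDiff ℝ 2 w ∧ ∀ k x y, ‖y‖ ≤ δ → |D2 w (u k) (x + y) - D2 w (u k) x| ≤ ε

variable {u : Fin d → Ed d} {h : ℝ}

theorem Avg_mono {w z : Ed d → ℝ} (hwz : ∀ y, w y ≤ z y) (x : Ed d) :
    Avg u h w x ≤ Avg u h z x := by
  unfold Avg
  refine mul_le_mul_of_nonneg_left (Finset.sum_le_sum fun k _ => add_le_add (hwz _) (hwz _))
    (by positivity)

theorem avg_const_aux (hd : 0 < d) (c : ℝ) : (1 / (2 * (d:ℝ))) * ∑ _k : Fin d, (c + c) = c := by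
  have : (0:ℝ) < d := by exact_mod_cast hd
  rw [Finset.sum_const, Finset.card_univ, Fintype.card_fin, nsmul_eq_mul]
  field_simp
  ring

theorem Avg_affine (hd : 0 < d) (c C : ℝ) (z : Ed d → ℝ) (x : Ed d) :
    Avg u h (fun y => c + C * z y) x = c + C * Avg u h z x := by
  unfold Avg
  have : ∀ k, ((c + C * z (x + h • u k)) + (c + C * z (x + (-h) • u k)))
      = (c + c) + C * (z (x + h • u k) + z (x + (-h) • u k)) := fun k => by ring
  rw [Finset.sum_congr rfl fun k _ => this k, Finset.sum_add_distrib, mul_add,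
    avg_const_aux hd, ← Finset.mul_sum]
  ring

theorem Avg_iter_mono {w z : Ed d → ℝ} (hwz : ∀ y, w y ≤ z y) (n : ℕ) (x : Ed d) :
    (Avg u h)^[n] w x ≤ (Avg u h)^[n] z x := by
  induction n generalizing x with
  | zero => exact hwz x
  | succ n ih =>
    rw [Function.iterate_succ_apply', Function.iterate_succ_apply']
    exact Avg_mono ih x

theorem Avg_iter_affine (hd : 0 < d) (c C : ℝ) (z : Ed d → ℝ) (n : ℕ) (x : Ed d) :
    (Avg u h)^[n] (fun y => c + C * z y) x = c + C * (Avg u h)^[n] z x := by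
  induction n generalizing x with
  | zero => rfl
  | succ n ih =>
    rw [Function.iterate_succ_apply', Function.iterate_succ_apply', ← Avg_affine hd]
    congr 1
    ext y; exact ih y

/-- trace -/
noncomputable def trS (u : Fin d → Ed d) : ℝ := (1 / (2 * (d:ℝ))) * ∑ k, (‖u k‖ ^ 2 + ‖u k‖ ^ 2)

theorem trS_nonneg : 0 ≤ trS u := by unfold trS; positivity

theorem Avg_sq (hd : 0 < d) (x y : Ed d) :
    Avg u h (fun y => ‖y - x‖ ^ 2) y = ‖y - x‖ ^ 2 + h ^ 2 * trS u := by
  unfold Avg trS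
  have : ∀ k, ‖y + h • u k - x‖ ^ 2 + ‖y + (-h) • u k - x‖ ^ 2
      = (‖y - x‖ ^ 2 + ‖y - x‖ ^ 2) + h ^ 2 * (‖u k‖ ^ 2 + ‖u k‖ ^ 2) := by
    intro k
    have e1 : y + h • u k - x = (y - x) + h • u k := by abel
    have e2 : y + (-h) • u k - x = (y - x) - h • u k := by rw [neg_smul]; abel
    have := parallelogram_law_with_norm ℝ (y - x) (h • u k)
    rw [e1, e2]
    have e3 : ‖h • u k‖ ^ 2 = h ^ 2 * ‖u k‖ ^ 2 := by
      rw [norm_smul, mul_pow, Real.norm_eq_abs, sq_abs]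
    nlinarith [this, e3]
  rw [Finset.sum_congr rfl fun k _ => this k, Finset.sum_add_distrib, mul_add,
    avg_const_aux hd, ← Finset.mul_sum]
  ring

theorem Avg_iter_quad (hd : 0 < d) {w : Ed d → ℝ} {x : Ed d} {c C : ℝ}
    (hw : ∀ y, w y ≤ c + C * ‖y - x‖ ^ 2) (n : ℕ) (y : Ed d) :
    (Avg u h)^[n] w y ≤ c + C * (n * h ^ 2) * trS u + C * ‖y - x‖ ^ 2 := by
  induction n generalizing y with
  | zero => simpa using hw y
  | succ n ih =>
    rw [Function.iterate_succ_apply']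
    refine (Avg_mono ih y).trans ?_
    rw [Avg_affine hd, Avg_sq hd]
    push_cast
    linarith

theorem Avg_contDiff {w : Ed d → ℝ} (hw : ContDiff ℝ 2 w) : ContDiff ℝ 2 (Avg u h w) := by
  unfold Avg
  refine contDiff_const.mul (ContDiff.sum fun k _ => ?_)
  exact (hw.comp (contDiff_id.add contDiff_const)).add (hw.comp (contDiff_id.add contDiff_const))

theorem D2_sum {ι : Type*} (s : Finset ι) {w : ι → Ed d → ℝ} (hw : ∀ i, ContDiff ℝ 2 (w i))
    (v x : Ed d) : D2 (fun y => ∑ i ∈ s, w i y) v x = ∑ i ∈ s, D2 (w i) v x := by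
  induction s using Finset.induction_on with
  | empty =>
    simp only [Finset.sum_empty]
    have : D2 ((0:ℝ) • (fun _ : Ed d => (0:ℝ))) v x = 0 * _ := D2_const_smul contDiff_const 0 v x
    rw [zero_mul] at this
    convert this using 2
    ext; simp
  | insert a s ha ih =>
    rw [Finset.sum_insert ha, ← ih, ← D2_add (hw a) (ContDiff.sum fun i _ => hw i)]
    congr 1
    ext y; simp [Finset.sum_insert ha]

theorem D2_Avg {w : Ed d → ℝ} (hw : ContDiff ℝ 2 w) (v x : Ed d) :
    D2 (Avg u h w) v x = Avg u h (D2 w v) x := by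
  have hs : ∀ a : Ed d, ContDiff ℝ 2 (fun y => w (y + a)) := fun a =>
    hw.comp (contDiff_id.add contDiff_const)
  have e : Avg u h w = (1 / (2 * (d:ℝ))) •
      (fun x => ∑ k, ((fun x => w (x + h • u k)) + (fun x => w (x + (-h) • u k))) x) := by
    ext x; simp [Avg]
  have hk : ∀ k, ContDiff ℝ 2 ((fun x => w (x + h • u k)) + (fun x => w (x + (-h) • u k))) :=
    fun k => (hs _).add (hs _)
  rw [e, D2_const_smul (ContDiff.sum fun k _ => hk k), D2_sum _ hk]
  unfold Avg
  congr 1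
  refine Finset.sum_congr rfl fun k _ => ?_
  rw [D2_add (hs _) (hs _), D2_shift, D2_shift]

theorem Avg_sub_abs (hd : 0 < d) {w z : Ed d → ℝ} {x x' : Ed d} {ε : ℝ}
    (hh : ∀ k, ∀ s, (s = h ∨ s = -h) → |w (x + s • u k) - z (x' + s • u k)| ≤ ε) :
    |Avg u h w x - Avg u h z x'| ≤ ε := by
  unfold Avg
  rw [← mul_sub, ← Finset.sum_sub_distrib, abs_mul, abs_of_nonneg (by positivity)]
  refine (mul_le_mul_of_nonneg_left (Finset.abs_sum_le_sum_abs _ _) (by positivity)).trans ?_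
  rw [← avg_const_aux hd ε]
  refine mul_le_mul_of_nonneg_left (Finset.sum_le_sum fun k _ => ?_) (by positivity)
  have h1 := hh k h (Or.inl rfl)
  have h2 := hh k (-h) (Or.inr rfl)
  rw [abs_le] at *
  constructor <;> linarith [h1.1, h1.2, h2.1, h2.2]

theorem Modu_Avg (hd : 0 < d) {w : Ed d → ℝ} {ε δ : ℝ} (hw : Modu u ε δ w) :
    Modu u ε δ (Avg u h w) := by
  refine ⟨Avg_contDiff hw.1, fun k x y hy => ?_⟩
  rw [D2_Avg hw.1, D2_Avg hw.1]
  refine Avg_sub_abs hd fun j s _ => ?_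
  have := hw.2 k (x + s • u j) y hy
  rwa [add_right_comm] at this

theorem Modu_iter (hd : 0 < d) {w : Ed d → ℝ} {ε δ : ℝ} (hw : Modu u ε δ w) (n : ℕ) :
    Modu u ε δ ((Avg u h)^[n] w) := by
  induction n with
  | zero => exact hw
  | succ n ih => rw [Function.iterate_succ_apply']; exact Modu_Avg hd ih

theorem Lop_Avg {w : Ed d → ℝ} (hw : ContDiff ℝ 2 w) :
    Lop u (Avg u h w) = Avg u h (Lop u w) := by
  ext x
  unfold Lop
  simp_rw [D2_Avg hw]
  unfold Avg
  rw [← Finset.mul_sum, Finset.sum_comm]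
  congr 1
  rw [Finset.mul_sum]
  refine Finset.sum_congr rfl fun j _ => ?_
  rw [Finset.sum_add_distrib]; ring

theorem Lop_iter (hd : 0 < d) {w : Ed d → ℝ} {ε δ : ℝ} (hw : Modu u ε δ w) (n : ℕ) :
    Lop u ((Avg u h)^[n] w) = (Avg u h)^[n] (Lop u w) := by
  induction n with
  | zero => rfl
  | succ n ih =>
    rw [Function.iterate_succ_apply', Function.iterate_succ_apply', Lop_Avg (Modu_iter hd hw n).1, ih]

theorem Avg_step (hd : 0 < d) {w : Ed d → ℝ} {ε δ : ℝ} (hw : Modu u ε δ w) (hh : 0 ≤ h)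
    (hδ : ∀ k, h * ‖u k‖ ≤ δ) (x : Ed d) :
    |Avg u h w x - w x - h ^ 2 * Lop u w x| ≤ ε * h ^ 2 := by
  have e : Avg u h w x - w x - h ^ 2 * Lop u w x = (1 / (2 * (d:ℝ))) *
      ∑ k, (w (x + h • u k) + w (x + (-h) • u k) - 2 * w x - h ^ 2 * D2 w (u k) x) := by
    have := avg_const_aux hd (w x)
    rw [← this]
    unfold Avg Lop
    rw [this]
    simp only [two_mul (w x)]
    rw [Finset.sum_sub_distrib, Finset.sum_sub_distrib, ← Finset.mul_sum]
    rw [mul_sub, mul_sub, this]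
    ring
  rw [e, abs_mul, abs_of_nonneg (by positivity)]
  refine (mul_le_mul_of_nonneg_left (Finset.abs_sum_le_sum_abs _ _) (by positivity)).trans ?_
  rw [← avg_const_aux hd (ε * h ^ 2)]
  refine mul_le_mul_of_nonneg_left (Finset.sum_le_sum fun k _ => ?_) (by positivity)
  refine (taylor_sym hw.1 x (u k) hh (ε := ε) fun s hs => ?_).trans (by linarith)
  refine hw.2 k x _ ?_
  rw [norm_smul, Real.norm_eq_abs]
  exact (mul_le_mul_of_nonneg_right hs (norm_nonneg _)).trans (hδ k)

theorem Lop_Avg_close (hd : 0 < d) {w : Ed d → ℝ} {ε δ : ℝ} (hw : Modu u ε δ w) (hh : 0 ≤ h)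
    (hδ : ∀ k, h * ‖u k‖ ≤ δ) (x : Ed d) :
    |Lop u (Avg u h w) x - Lop u w x| ≤ ε := by
  have e : Lop u (Avg u h w) x - Lop u w x =
      (1 / (2 * (d:ℝ))) * ∑ k, (D2 (Avg u h w) (u k) x - D2 w (u k) x) := by
    unfold Lop; rw [Finset.sum_sub_distrib]; ring
  have hd' : (0:ℝ) < d := by exact_mod_cast hd
  have hD : ∀ k, |D2 (Avg u h w) (u k) x - D2 w (u k) x| ≤ ε := by
    intro k
    rw [D2_Avg hw.1]
    have e1 : D2 w (u k) x = Avg u h (fun _ => D2 w (u k) x) x := by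
      unfold Avg; rw [avg_const_aux hd]
    rw [e1]
    refine Avg_sub_abs hd fun j s hs => ?_
    refine hw.2 k x _ ?_
    rw [norm_smul, Real.norm_eq_abs]
    have : |s| = h := by rcases hs with rfl | rfl <;> simp [abs_of_nonneg hh]
    rw [this]; exact hδ j
  have e0 : 0 ≤ ε := (abs_nonneg _).trans (hD ⟨0, hd⟩)
  rw [e, abs_mul, abs_of_nonneg (by positivity)]
  refine (mul_le_mul_of_nonneg_left (Finset.abs_sum_le_sum_abs _ _) (by positivity)).trans ?_
  rw [← avg_const_aux hd ε]
  refine mul_le_mul_of_nonneg_left (Finset.sum_le_sum fun k _ => ?_) (by positivity)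
  linarith [hD k]

end partW

open MeasureTheory Set Filter Topology
open scoped ENNReal NNReal Classical

section partW
variable {d : ℕ}

theorem cc_quad {w : Ed d → ℝ} (hw : Continuous w) (hc : HasCompactSupport w) {ε : ℝ} (hε : 0 < ε) :
    ∃ C, 0 ≤ C ∧ ∀ x y, |w y - w x| ≤ ε + C * ‖y - x‖ ^ 2 := by
  obtain ⟨B, hB⟩ := hc.exists_bound_of_continuous hw
  have hB0 : 0 ≤ B := (norm_nonneg _).trans (hB 0)
  obtain ⟨δ, hδ, h⟩ := Metric.uniformContinuous_iff.1 (hc.uniformContinuous_of_continuous hw) ε hε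
  refine ⟨2 * B / δ ^ 2, by positivity, fun x y => ?_⟩
  by_cases hxy : dist y x < δ
  · have := h hxy
    rw [Real.dist_eq] at this
    have : 0 ≤ 2 * B / δ ^ 2 * ‖y - x‖ ^ 2 := by positivity
    linarith
  · push Not at hxy
    rw [dist_eq_norm] at hxy
    have h1 : |w y - w x| ≤ 2 * B := by
      have := hB x; have := hB y
      rw [Real.norm_eq_abs] at *
      rw [abs_le] at *
      constructor <;> linarith [(hB x)]
    have h2 : 2 * B ≤ 2 * B / δ ^ 2 * ‖y - x‖ ^ 2 := by
      rw [div_mul_eq_mul_div, le_div_iff₀ (by positivity)]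
      gcongr
    linarith

theorem D2_continuous {w : Ed d → ℝ} (hw : ContDiff ℝ 2 w) (v : Ed d) : Continuous (D2 w v) := by
  unfold D2
  have := hw.continuous_iteratedFDeriv (m := 2) le_rfl
  exact (continuous_eval_const (F := ContinuousMultilinearMap ℝ (fun _ : Fin 2 => Ed d) ℝ) ![v, v]).comp this

theorem D2_compact {w : Ed d → ℝ} (hw : HasCompactSupport w) (v : Ed d) :
    HasCompactSupport (D2 w v) := by
  have := hw.iteratedFDeriv (𝕜 := ℝ) 2
  exact this.comp_left (g := fun T : ContinuousMultilinearMap ℝ (fun _ : Fin 2 => Ed d) ℝ => T ![v, v]) rfl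

theorem D2_sub_const {w : Ed d → ℝ} (hw : ContDiff ℝ 2 w) (c : ℝ) (v x : Ed d) :
    D2 (fun y => w y - c) v x = D2 w v x := by
  have e : (fun y => w y - c) = w + fun _ => -c := by ext y; simp [sub_eq_add_neg]
  rw [e, D2_add hw contDiff_const]
  have : D2 (fun _ : Ed d => -c) v x = 0 := by
    unfold D2
    rw [iteratedFDeriv_const_of_ne (by norm_num)]; rfl
  rw [this, add_zero]

theorem Modu_exists (u : Fin d → Ed d) {w : Ed d → ℝ} (hw : IsC2c w) {ε : ℝ} (hε : 0 < ε) :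
    ∃ δ, 0 < δ ∧ Modu u ε δ w := by
  have h : ∀ k, ∃ δ > 0, ∀ x y : Ed d, dist x y < δ → dist (D2 w (u k) x) (D2 w (u k) y) < ε :=
    fun k => by
      have := Metric.uniformContinuous_iff.1
        ((D2_compact hw.2 (u k)).uniformContinuous_of_continuous (D2_continuous hw.1 (u k))) ε hε
      obtain ⟨δ, h1, h2⟩ := this
      exact ⟨δ, h1, fun x y h => h2 h⟩
  choose δ hδ h using h
  have : ∃ r > 0, ∀ k, r < δ k := by
    have : ∀ᶠ r in 𝓝[>] (0:ℝ), ∀ k, r < δ k := by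
      rw [Filter.eventually_all]
      intro k
      exact nhdsWithin_le_nhds (eventually_lt_nhds (hδ k))
    obtain ⟨r, h1, h2⟩ := (this.and self_mem_nhdsWithin).exists
    exact ⟨r, h2, h1⟩
  obtain ⟨r, hr, hr2⟩ := this
  refine ⟨r, hr, hw.1, fun k x y hy => ?_⟩
  have := h k (x + y) x (by rw [dist_eq_norm]; simpa using hy.trans_lt (hr2 k))
  rw [Real.dist_eq] at this
  exact this.le

theorem Modu_sub_const {u : Fin d → Ed d} {w : Ed d → ℝ} {ε δ : ℝ} (h : Modu u ε δ w) (c : ℝ) :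
    Modu u ε δ (fun y => w y - c) := by
  refine ⟨h.1.sub contDiff_const, fun k x y hy => ?_⟩
  rw [D2_sub_const h.1, D2_sub_const h.1]
  exact h.2 k x y hy

theorem Modu_mono {u : Fin d → Ed d} {w : Ed d → ℝ} {ε δ δ' : ℝ} (h : Modu u ε δ w) (hδ : δ' ≤ δ) :
    Modu u ε δ' w := ⟨h.1, fun k x y hy => h.2 k x y (hy.trans hδ)⟩

theorem Lop_cc (u : Fin d → Ed d) {w : Ed d → ℝ} (hw : IsC2c w) :
    Continuous (Lop u w) ∧ HasCompactSupport (Lop u w) := by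
  constructor
  · unfold Lop
    exact continuous_const.mul (continuous_finsetSum _ fun k _ => D2_continuous hw.1 (u k))
  · have : HasCompactSupport (fun x => (fun k => D2 w (u k) x : Fin d → ℝ)) := by
      refine HasCompactSupport.intro (K := tsupport (iteratedFDeriv ℝ 2 w)) (hw.2.iteratedFDeriv 2) ?_
      intro x hx
      ext k
      have := image_eq_zero_of_notMem_tsupport hx
      simp [D2, this]
    exact this.comp_left (g := fun z : Fin d → ℝ => (1 / (2 * (d:ℝ))) * ∑ k, z k) (by simp)

/-- mollification -/
noncomputable def moll (φ : ContDiffBump (0 : Ed d)) (w : Ed d → ℝ) (x : Ed d) : ℝ :=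
  ∫ t, φ.normed volume t * w (x - t)

theorem moll_int (φ : ContDiffBump (0 : Ed d)) {w : Ed d → ℝ} (hw : Continuous w) (x : Ed d) :
    Integrable (fun t => φ.normed volume t * w (x - t)) := by
  refine Continuous.integrable_of_hasCompactSupport ?_ ?_
  · exact φ.continuous_normed.mul (hw.comp (continuous_const.sub continuous_id))
  · exact φ.hasCompactSupport_normed.mul_right

theorem moll_eq (φ : ContDiffBump (0 : Ed d)) (w : Ed d → ℝ) :
    moll φ w = MeasureTheory.convolution (φ.normed volume) w (ContinuousLinearMap.lsmul ℝ ℝ) volume := by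
  ext x
  simp [moll, MeasureTheory.convolution_def]

theorem moll_C2c (φ : ContDiffBump (0 : Ed d)) {w : Ed d → ℝ} (hw : Continuous w)
    (hc : HasCompactSupport w) : IsC2c (moll φ w) := by
  rw [moll_eq]
  exact ⟨φ.hasCompactSupport_normed.contDiff_convolution_left _ φ.contDiff_normed hw.locallyIntegrable,
    φ.hasCompactSupport_normed.convolution _ hc⟩

theorem moll_close (φ : ContDiffBump (0 : Ed d)) {w : Ed d → ℝ} (hw : Continuous w) {x : Ed d} {ε : ℝ}
    (h : ∀ y, dist y x < φ.rOut → |w y - w x| ≤ ε) : |moll φ w x - w x| ≤ ε := by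
  rw [moll_eq]
  have := φ.dist_normed_convolution_le (μ := volume) (g := w) (x₀ := x) (ε := ε)
    hw.aestronglyMeasurable (fun y hy => by rw [Real.dist_eq]; exact h y hy)
  rwa [Real.dist_eq] at this

theorem moll_Avg (u : Fin d → Ed d) (h : ℝ) (φ : ContDiffBump (0 : Ed d)) {w : Ed d → ℝ} (hw : Continuous w) :
    moll φ (Avg u h w) = Avg u h (moll φ w) := by
  ext x
  unfold moll Avg
  have e : ∀ t, φ.normed volume t * (1 / (2 * (d:ℝ)) * ∑ k, (w (x - t + h • u k) + w (x - t + (-h) • u k)))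
      = 1 / (2 * (d:ℝ)) * ∑ k, (φ.normed volume t * w (x + h • u k - t) +
        φ.normed volume t * w (x + (-h) • u k - t)) := by
    intro t
    rw [mul_left_comm, Finset.mul_sum]
    congr 1
    refine Finset.sum_congr rfl fun k _ => ?_
    rw [mul_add, sub_add_eq_add_sub, sub_add_eq_add_sub]
  simp_rw [e]
  rw [integral_const_mul]
  congr 1
  refine (integral_finsetSum _ (fun k _ => (moll_int φ hw (x + h • u k)).add
    (moll_int φ hw (x + (-h) • u k)))).trans ?_
  refine Finset.sum_congr rfl fun k _ => ?_
  exact integral_add (moll_int φ hw _) (moll_int φ hw _)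

theorem Avg_continuous {u : Fin d → Ed d} {h : ℝ} {w : Ed d → ℝ} (hw : Continuous w) :
    Continuous (Avg u h w) := by
  unfold Avg; fun_prop

theorem Avg_iter_continuous {u : Fin d → Ed d} {h : ℝ} {w : Ed d → ℝ} (hw : Continuous w) (n : ℕ) :
    Continuous ((Avg u h)^[n] w) := by
  induction n with
  | zero => exact hw
  | succ n ih => rw [Function.iterate_succ_apply']; exact Avg_continuous ih

theorem moll_Avg_iter (u : Fin d → Ed d) (h : ℝ) (φ : ContDiffBump (0 : Ed d)) {w : Ed d → ℝ}
    (hw : Continuous w) (n : ℕ) :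
    moll φ ((Avg u h)^[n] w) = (Avg u h)^[n] (moll φ w) := by
  induction n with
  | zero => rfl
  | succ n ih =>
    rw [Function.iterate_succ_apply', Function.iterate_succ_apply', ← ih,
      moll_Avg _ _ _ (Avg_iter_continuous hw n)]

theorem moll_le (φ : ContDiffBump (0 : Ed d)) {w z : Ed d → ℝ} (hw : Continuous w) (hz : Continuous z)
    {x : Ed d} {K : ℝ} (h : ∀ y, dist y x ≤ φ.rOut → w y ≤ z y + K) : moll φ w x ≤ moll φ z x + K := by
  have hK : ∫ t, φ.normed volume t * K = K := by
    rw [integral_mul_const, φ.integral_normed, one_mul]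
  have hi : Integrable (fun t => φ.normed volume t * K) := (φ.integrable_normed).mul_const K
  unfold moll
  rw [← hK, ← integral_add (moll_int φ hz x) hi]
  refine integral_mono (moll_int φ hw x) ((moll_int φ hz x).add hi) fun t => ?_
  show _ ≤ _ + _
  rw [← mul_add]
  by_cases ht : t ∈ Metric.ball (0 : Ed d) φ.rOut
  · refine mul_le_mul_of_nonneg_left (h _ ?_) (φ.nonneg_normed t)
    rw [dist_eq_norm]
    have : x - t - x = -t := by abel
    rw [this, norm_neg]
    simpa using (mem_ball_zero_iff.1 ht).le
  · have : φ.normed volume t = 0 := by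
      by_contra hne
      have h2 : t ∈ Function.support (φ.normed volume) := hne
      rw [φ.support_normed_eq] at h2
      exact ht h2
    simp [this]

end partW

open MeasureTheory Set Filter Topology
open scoped ENNReal NNReal Classical

section partW
variable {d : ℕ}

theorem discrete_comparison (hd : 0 < d) {u : Fin d → Ed d} {ψ v w0 : Ed d → ℝ} {x0 : Ed d} {R : ℝ}
    (h1 : ∀ x ∈ Metric.closedBall x0 R, v x ≤ ψ x)
    (h3 : ∀ x ∈ Metric.sphere x0 R, v x ≤ ψ x - 1)
    (hψ : ContinuousOn ψ (Metric.closedBall x0 R))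
    (hR : 0 < R)
    (hv : ∀ w : Ed d → ℝ, ContDiff ℝ 2 w → ∀ x1 ∈ Metric.ball x0 R,
      IsMaxOn (fun x => w x - ψ x) (Metric.closedBall x0 R) x1 → Lop u w x1 ≤ 1)
    (hw0 : ∀ x, w0 x ≤ v x) {ε δ h C T : ℝ} (hε : 0 < ε) (hmod : Modu u ε δ w0) (hh : 0 ≤ h)
    (hδ : ∀ k, h * ‖u k‖ ≤ δ) (hC0 : 0 ≤ C)
    (hC : ∀ x y, |v y - v x| ≤ 1/4 + C * ‖y - x‖ ^ 2) (hT : C * T * trS u ≤ 1/4)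
    (n : ℕ) (hn : n * h ^ 2 ≤ T) :
    ∀ x ∈ Metric.closedBall x0 R, (Avg u h)^[n] w0 x ≤ ψ x + (1 + 2 * ε) * (n * h ^ 2) := by
  have claim1 : ∀ n : ℕ, n * h ^ 2 ≤ T → ∀ x, (Avg u h)^[n] w0 x ≤ v x + 1 / 2 := by
    intro n hn x
    have := Avg_iter_quad (u := u) (h := h) hd (w := w0) (x := x) (c := v x + 1/4) (C := C)
      (fun y => by have := hC x y; rw [abs_le] at this; linarith [hw0 y, this.2]) n x
    simp only [sub_self, norm_zero] at this
    have h2 : C * (n * h ^ 2) * trS u ≤ C * T * trS u := by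
      gcongr
      exact trS_nonneg
    linarith
  induction n with
  | zero =>
    intro x hx
    simpa using (hw0 x).trans (h1 x hx)
  | succ n ih =>
    have hn' : n * h ^ 2 ≤ T := by
      refine le_trans ?_ hn
      push_cast
      nlinarith [sq_nonneg h]
    have ih := ih hn'
    have hM := Modu_iter (h := h) hd hmod n
    have hM' := Modu_iter (h := h) hd hmod (n + 1)
    obtain ⟨x1, hx1, hmax⟩ := (isCompact_closedBall x0 R).exists_isMaxOn
      ⟨x0, Metric.mem_closedBall_self hR.le⟩ (hM'.1.continuous.continuousOn.sub hψ)
    have key : (Avg u h)^[n+1] w0 x1 - ψ x1 ≤ (1 + 2 * ε) * ((n + 1 : ℕ) * h ^ 2) := by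
      by_cases hb : x1 ∈ Metric.ball x0 R
      · have hL := hv _ hM'.1 x1 hb hmax
        have s1 := Avg_step hd hM hh hδ x1
        have s2 := Lop_Avg_close hd hM hh hδ x1
        have s3 := ih x1 hx1
        rw [Function.iterate_succ_apply'] at hL ⊢
        rw [abs_le] at s1 s2
        have s4 : h ^ 2 * Lop u ((Avg u h)^[n] w0) x1 ≤ h ^ 2 * (1 + ε) := by
          gcongr
          linarith [s2.1]
        push_cast
        nlinarith [s1.2]
      · have hs : x1 ∈ Metric.sphere x0 R := by
          rw [Metric.mem_sphere]; rw [Metric.mem_ball] at hb; rw [Metric.mem_closedBall] at hx1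
          push Not at hb
          exact le_antisymm hx1 hb
        have a1 := h3 x1 hs
        have a2 := claim1 (n+1) hn x1
        have : 0 ≤ (1 + 2 * ε) * ((n + 1 : ℕ) * h ^ 2) := by positivity
        linarith
    intro x hx
    have : (Avg u h)^[n+1] w0 x - ψ x ≤ (Avg u h)^[n+1] w0 x1 - ψ x1 := hmax hx
    linarith

theorem visc_moll (hd : 0 < d) {u : Fin d → Ed d} {ψ v : Ed d → ℝ} {x0 : Ed d} {R : ℝ}
    (hvc : Continuous v) (hvs : HasCompactSupport v)
    (h1 : ∀ x ∈ Metric.closedBall x0 R, v x ≤ ψ x)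
    (h2 : ∀ x ∈ Metric.closedBall x0 (R/2), ψ x = v x)
    (h3 : ∀ x ∈ Metric.sphere x0 R, v x ≤ ψ x - 1)
    (hψ : ContinuousOn ψ (Metric.closedBall x0 R))
    (hR : 0 < R)
    (hv : ∀ w : Ed d → ℝ, ContDiff ℝ 2 w → ∀ x1 ∈ Metric.ball x0 R,
      IsMaxOn (fun x => w x - ψ x) (Metric.closedBall x0 R) x1 → Lop u w x1 ≤ 1)
    (φ : ContDiffBump (0 : Ed d)) (hφ : φ.rOut ≤ R / 2) : Lop u (moll φ v) x0 ≤ 1 := by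
  set g := moll φ v with hg
  have hgC : IsC2c g := moll_C2c φ hvc hvs
  refine le_of_forall_pos_le_add fun ε' hε' => ?_
  set ε := ε' / 6 with hεdef
  have hε : 0 < ε := by positivity
  obtain ⟨C1, hC1, hC1'⟩ := cc_quad hvc hvs (ε := 1/4) (by norm_num)
  obtain ⟨C2, hC2, hC2'⟩ := cc_quad (Lop_cc u hgC).1 (Lop_cc u hgC).2 hε
  have hS : 0 ≤ trS u := trS_nonneg
  set T := min (1/4) ε / (C1 * trS u + C2 * trS u + 1) with hTdef
  have hden : 0 < C1 * trS u + C2 * trS u + 1 := by positivity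
  have hT : 0 < T := by positivity
  have hT1 : C1 * T * trS u ≤ 1/4 := by
    have : T * (C1 * trS u + C2 * trS u + 1) = min (1/4) ε := by
      rw [hTdef]; field_simp
    have h5 : 0 ≤ T * (C2 * trS u) := by positivity
    nlinarith [min_le_left (1/4) ε]
  have hT2 : C2 * T * trS u ≤ ε := by
    have : T * (C1 * trS u + C2 * trS u + 1) = min (1/4) ε := by
      rw [hTdef]; field_simp
    have h5 : 0 ≤ T * (C1 * trS u) := by positivity
    nlinarith [min_le_right (1/4) ε]
  set τ := ε * T / 2 with hτ
  have hτ0 : 0 < τ := by positivity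
  -- smooth approximation of v
  obtain ⟨δ0, hδ0, hunif⟩ := Metric.uniformContinuous_iff.1 (hvs.uniformContinuous_of_continuous hvc) τ hτ0
  let φ' : ContDiffBump (0 : Ed d) := ⟨δ0 / 2, δ0, by positivity, by linarith⟩
  have hclose : ∀ x, |moll φ' v x - v x| ≤ τ := fun x => moll_close φ' hvc fun y hy => by
    have := hunif (a := y) (b := x) hy
    rw [Real.dist_eq] at this; exact this.le
  have hw0C : IsC2c (moll φ' v) := moll_C2c φ' hvc hvs
  obtain ⟨δ1, hδ1, hm1⟩ := Modu_exists u hw0C hε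
  obtain ⟨δ2, hδ2, hm2⟩ := Modu_exists u hgC hε
  set δ := min δ1 δ2 with hδdef
  have hδ : 0 < δ := lt_min hδ1 hδ2
  set w0 : Ed d → ℝ := fun y => moll φ' v y - τ with hw0
  have hmod0 : Modu u ε δ w0 := Modu_mono (Modu_sub_const hm1 τ) (min_le_left _ _)
  have hmodg : Modu u ε δ g := Modu_mono hm2 (min_le_right _ _)
  have hw0v : ∀ x, w0 x ≤ v x := fun x => by
    have := hclose x; rw [abs_le] at this; simp only [hw0]; linarith [this.2]
  have hvw0 : ∀ x, v x ≤ 2 * τ + 1 * w0 x := fun x => by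
    have := hclose x; rw [abs_le] at this; simp only [hw0]; linarith [this.1]
  -- choose N and h
  obtain ⟨B, hB0, hB⟩ : ∃ B : ℝ, 0 ≤ B ∧ ∀ k, ‖u k‖ ≤ B :=
    ⟨∑ k, ‖u k‖, by positivity, fun k =>
      Finset.single_le_sum (f := fun k => ‖u k‖) (fun i _ => norm_nonneg _) (Finset.mem_univ k)⟩
  obtain ⟨N, hN⟩ := exists_nat_gt (T / (δ / (B + 1)) ^ 2)
  have hNpos : (0:ℝ) < N := lt_of_le_of_lt (by positivity) hN
  set h := Real.sqrt (T / N) with hh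
  have hh0 : 0 ≤ h := Real.sqrt_nonneg _
  have hh2 : h ^ 2 = T / N := Real.sq_sqrt (by positivity)
  have hNh : N * h ^ 2 = T := by rw [hh2]; field_simp
  have hhδ : h ≤ δ / (B + 1) := by
    rw [hh]
    refine Real.sqrt_le_iff.2 ⟨by positivity, ?_⟩
    rw [div_le_iff₀ hNpos]
    rw [div_lt_iff₀ (by positivity)] at hN
    linarith
  have hhδ' : ∀ k, h * ‖u k‖ ≤ δ := fun k => by
    have : h * ‖u k‖ ≤ δ / (B + 1) * (B + 1) := by
      gcongr
      linarith [hB k]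
    rwa [div_mul_cancel₀ _ (by positivity)] at this
  -- upper bound
  have up := discrete_comparison hd h1 h3 hψ hR hv hw0v hε hmod0 hh0 hhδ' hC1 hC1' hT1 N hNh.le
  have up2 : (Avg u h)^[N] g x0 ≤ g x0 + (1 + 3 * ε) * T := by
    rw [hg, ← moll_Avg_iter u h φ hvc N]
    refine moll_le φ (Avg_iter_continuous hvc N) hvc fun y hy => ?_
    have hy1 : y ∈ Metric.closedBall x0 (R/2) := hy.trans hφ
    have hy2 : y ∈ Metric.closedBall x0 R := Metric.closedBall_subset_closedBall (by linarith) hy1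
    have a1 := up y hy2
    have a2 := Avg_iter_mono (u := u) (h := h) hvw0 N y
    rw [Avg_iter_affine hd] at a2
    rw [hNh, h2 y hy1] at a1
    have : 2 * τ = ε * T := by rw [hτ]; ring
    linarith
  -- lower bound
  have low : ∀ n : ℕ, n * h ^ 2 ≤ T →
      g x0 + n * h ^ 2 * (Lop u g x0 - 3 * ε) ≤ (Avg u h)^[n] g x0 := by
    intro n
    induction n with
    | zero => intro _; simp
    | succ n ih =>
      intro hn
      have hn' : n * h ^ 2 ≤ T := by
        refine le_trans ?_ hn
        push_cast
        nlinarith [sq_nonneg h]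
      have ih := ih hn'
      have s1 := Avg_step hd (Modu_iter (h := h) hd hmodg n) hh0 hhδ' x0
      rw [Lop_iter hd hmodg] at s1
      have s2 := Avg_iter_quad (u := u) (h := h) hd (w := fun y => 0 + (-1) * Lop u g y) (x := x0)
        (c := - Lop u g x0 + ε) (C := C2)
        (fun y => by have := hC2' x0 y; rw [abs_le] at this; linarith [this.1]) n x0
      rw [Avg_iter_affine hd] at s2
      simp only [sub_self, norm_zero] at s2
      have s3 : C2 * (n * h ^ 2) * trS u ≤ C2 * T * trS u := by gcongr
      rw [Function.iterate_succ_apply']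
      rw [abs_le] at s1
      have s4 : h ^ 2 * (Lop u g x0 - 2 * ε) ≤ h ^ 2 * (Avg u h)^[n] (Lop u g) x0 := by
        gcongr
        linarith
      push_cast
      nlinarith [s1.1]
  have lowN := low N hNh.le
  rw [hNh] at lowN
  have : T * (Lop u g x0 - 3 * ε) ≤ T * (1 + 3 * ε) := by linarith
  have := le_of_mul_le_mul_left this hT
  have : 6 * ε = ε' := by rw [hεdef]; ring
  linarith

end partW

open MeasureTheory Set Filter Topology
open scoped ENNReal NNReal Classical

section partW
variable {d : ℕ}

/-- assumption (A3) -/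
def A3 (f : Matd d → ℝ≥0∞) : Prop := (∀ M : Matd d, f M ≠ ⊤ ↔ M.PosSemidef) ∧
      ∃ k : ℝ, 0 < k ∧ ∀ A : Matd d, A.PosSemidef → f A ≤ ENNReal.ofReal (k * A.trace)

theorem matnorm_pos {M : Matd d} (hd : 0 < d) (hM : M.PosDef) : 0 < matnorm M := by
  have h := hM.diag_pos (i := ⟨0, hd⟩)
  exact h.trans_le ((le_abs_self _).trans (abs_le_matnorm M _ _))

theorem kset_of_posdef (hd : 0 < d) {f : Matd d → ℝ≥0∞} (hA1 : CostA1 f) (hA3 : A3 f) {A : Matd d}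
    (h : ∀ M : Matd d, M.PosDef → f M = 1 → (1/2 : ℝ) * frob A M ≤ 1) {M : Fin d → Fin d → ℝ}
    (hM : M ∈ Kset f) : (1/2 : ℝ) * frob A M ≤ 1 := by
  have hpsd := Kset_psd hA1 hM
  obtain ⟨c, hc, hcoer⟩ := hA1.2.1
  have h1 : f 1 ≠ ⊤ := (hA3.1 1).2 Matrix.PosSemidef.one
  set F1 := (f 1).toReal with hF1
  have key : ∀ s : ℝ, 0 < s → (1/2 : ℝ) * frob A M + s * ((1/2) * frob A 1) ≤ 1 + s * F1 := by
    intro s hs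
    have hpd : (Matrix.of M + s • (1 : Matd d)).PosDef :=
      (Matrix.PosDef.one.smul hs).posSemidef_add hpsd
    set N : Matd d := Matrix.of M + s • (1 : Matd d) with hN
    have hf : f N ≤ ENNReal.ofReal (1 + s * F1) := by
      refine (hA1.2.2.1 _ _).trans ?_
      rw [hA1.2.2.2 s hs.le, ENNReal.ofReal_add zero_le_one (by positivity), ENNReal.ofReal_mul hs.le,
        hF1, ENNReal.ofReal_toReal h1, ENNReal.ofReal_one]
      gcongr
      exact hM
    have hft : f N ≠ ⊤ := (hf.trans_lt ENNReal.ofReal_lt_top).ne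
    set r := (f N).toReal with hr
    have hr0 : 0 < r := by
      have := hcoer N
      refine ENNReal.toReal_pos ?_ hft
      intro h0
      rw [h0] at this
      have h2 := ENNReal.ofReal_eq_zero.1 (le_antisymm this zero_le)
      have := mul_pos hc (matnorm_pos hd hpd)
      linarith
    have hr1 : r ≤ 1 + s * F1 := ENNReal.toReal_le_of_le_ofReal (by positivity) hf
    have hpd2 : (r⁻¹ • N).PosDef := hpd.smul (inv_pos.2 hr0)
    have hf2 : f (r⁻¹ • N) = 1 := by
      rw [hA1.2.2.2 _ (inv_pos.2 hr0).le, ENNReal.ofReal_inv_of_pos hr0, hr, ENNReal.ofReal_toReal hft]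
      refine ENNReal.inv_mul_cancel ?_ hft
      intro h0
      rw [hr, h0] at hr0
      simp at hr0
    have := h _ hpd2 hf2
    rw [frob_smul_right] at this
    have h3 : (1/2 : ℝ) * frob A N ≤ r := by
      have : r * ((1/2 : ℝ) * (r⁻¹ * frob A N)) ≤ r * 1 := by gcongr
      have e : r * ((1/2 : ℝ) * (r⁻¹ * frob A N)) = (1/2) * frob A N := by field_simp
      linarith
    rw [hN, frob_add_right, frob_smul_right] at h3
    have h4 : frob A (Matrix.of M) = frob A M := rfl
    rw [h4] at h3
    linarith
  have hlim : Tendsto (fun s : ℝ => 1 + s * F1 - s * ((1/2) * frob A 1)) (𝓝[>] 0) (𝓝 1) := by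
    have : Continuous (fun s : ℝ => 1 + s * F1 - s * ((1/2) * frob A 1)) := by fun_prop
    have h2 := this.tendsto 0
    simp only [zero_mul, add_zero, sub_zero] at h2
    exact h2.mono_left nhdsWithin_le_nhds
  refine ge_of_tendsto hlim ?_
  filter_upwards [self_mem_nhdsWithin] with s hs
  have := key s hs
  linarith

theorem Lop_frob (hd : 0 < d) (v : Fin d → Ed d) (w : Ed d → ℝ) (x : Ed d) :
    Lop (fun k => Real.sqrt d • v k) w x =
      (1/2 : ℝ) * frob (hess w x) (∑ k, Matrix.vecMulVec (v k) (v k)) := by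
  have : (0:ℝ) < d := by exact_mod_cast hd
  rw [frob_hess_decomp]
  unfold Lop
  simp_rw [D2_smul, Real.sq_sqrt this.le]
  rw [← Finset.mul_sum]
  field_simp

theorem moll_local_eq (φ : ContDiffBump (0 : Ed d)) {w z : Ed d → ℝ} (hw : Continuous w)
    (hz : Continuous z) {x0 : Ed d} {r : ℝ} (hr : φ.rOut < r)
    (h : ∀ x ∈ Metric.closedBall x0 r, w x = z x) : moll φ w =ᶠ[𝓝 x0] moll φ z := by
  filter_upwards [Metric.ball_mem_nhds x0 (sub_pos.2 hr)] with x hx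
  have hb : ∀ y, dist y x ≤ φ.rOut → w y = z y := fun y hy => by
    refine h y ?_
    have := dist_triangle y x x0
    rw [Metric.mem_ball] at hx
    rw [Metric.mem_closedBall]
    linarith
  refine le_antisymm ?_ ?_
  · have := moll_le φ hw hz (x := x) (K := 0) (fun y hy => by rw [hb y hy]; simp)
    linarith
  · have := moll_le φ hz hw (x := x) (K := 0) (fun y hy => by rw [hb y hy]; simp)
    linarith

theorem visc_adm (hd : 0 < d) {f : Matd d → ℝ≥0∞} {U : Set (Ed d)} (hU : IsOpen U) {ψ ψt : Ed d → ℝ}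
    (hvisc : IsViscSupersol f 1 ψ U) {x0 : Ed d} {R : ℝ} (hR : 0 < R)
    (hb : Metric.closedBall x0 R ⊆ U) (hc : Continuous ψt) (hs : HasCompactSupport ψt)
    (heq : ∀ x ∈ Metric.closedBall x0 R, ψt x = ψ x)
    (φ : ContDiffBump (0 : Ed d)) (hφ : φ.rOut < R / 2) (M : Matd d) (hM : M.PosDef) (hf : f M = 1) :
    (1/2 : ℝ) * frob (hess (moll φ ψt) x0) M ≤ 1 := by
  obtain ⟨v, hv⟩ := psd_decomp hM.posSemidef
  let ρ : Ed d → ℝ := fun x => max 0 (1 - (2 / R) * |dist x x0 - R|)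
  have hρc : Continuous ρ := by fun_prop
  have hρs : HasCompactSupport ρ := by
    refine HasCompactSupport.intro (isCompact_closedBall x0 (2 * R)) fun x hx => ?_
    rw [Metric.mem_closedBall] at hx
    push Not at hx
    have : 1 ≤ (2 / R) * |dist x x0 - R| := by
      rw [div_mul_eq_mul_div, le_div_iff₀ hR]
      have := le_abs_self (dist x x0 - R)
      linarith
    simp only [ρ]
    exact max_eq_left (by linarith)
  have hρ0 : ∀ x, 0 ≤ ρ x := fun x => le_max_left _ _
  have hρ1 : ∀ x ∈ Metric.closedBall x0 (R/2), ρ x = 0 := fun x hx => by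
    rw [Metric.mem_closedBall] at hx
    have : 1 ≤ (2 / R) * |dist x x0 - R| := by
      rw [div_mul_eq_mul_div, le_div_iff₀ hR]
      have := neg_le_abs (dist x x0 - R)
      linarith
    simp only [ρ]
    exact max_eq_left (by linarith)
  have hρ2 : ∀ x ∈ Metric.sphere x0 R, ρ x = 1 := fun x hx => by
    rw [Metric.mem_sphere] at hx
    simp [ρ, hx]
  let w : Ed d → ℝ := fun x => ψt x - ρ x
  have hwc : Continuous w := hc.sub hρc
  have hws : HasCompactSupport w := hs.sub hρs
  have e1 : moll φ ψt =ᶠ[𝓝 x0] moll φ w := moll_local_eq φ hc hwc hφ fun x hx => by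
    simp [w, hρ1 x hx]
  have hsub : Metric.closedBall x0 (R/2) ⊆ Metric.closedBall x0 R :=
    Metric.closedBall_subset_closedBall (by linarith)
  rw [hess_congr e1, hv, ← Lop_frob hd]
  refine visc_moll hd (ψ := ψ) hwc hws (R := R) ?_ ?_ ?_ ?_ hR ?_ φ hφ.le
  · intro x hx
    have := heq x hx; have := hρ0 x
    simp only [w]; linarith
  · intro x hx
    simp [w, hρ1 x hx, heq x (hsub hx)]
  · intro x hx
    simp [w, hρ2 x hx, heq x (Metric.sphere_subset_closedBall hx)]
  · exact hc.continuousOn.congr fun x hx => (heq x hx).symm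
  · intro z hz x1 hx1 hmax
    rw [Lop_frob hd, ← hv]
    have hm : IsLocalMinOn (fun y => ψ y - z y) U x1 := by
      have : ∀ᶠ y in 𝓝 x1, ψ x1 - z x1 ≤ ψ y - z y := by
        filter_upwards [Metric.isOpen_ball.mem_nhds hx1] with y hy
        have : z y - ψ y ≤ z x1 - ψ x1 := hmax (Metric.ball_subset_closedBall hy)
        linarith
      exact this.filter_mono nhdsWithin_le_nhds
    have h1 := hvisc z hz.contDiffOn x1 (hb (Metric.ball_subset_closedBall hx1)) hm
    have h2 : ((frob ((1/2 : ℝ) • hess z x1) M : ℝ) : EReal) ≤ ((1:ℝ) : EReal) :=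
      le_trans (le_sSup (s := { c : EReal | ∃ M' : Matd d, M'.PosDef ∧ f M' = 1 ∧
        c = ((frob ((1/2 : ℝ) • hess z x1) M' : ℝ) : EReal) }) ⟨M, hM, hf, rfl⟩) h1
    rw [EReal.coe_le_coe_iff, frob_smul_left] at h2
    exact h2

theorem B_le_F (hd : 0 < d) {f : Matd d → ℝ≥0∞} (hA1 : CostA1 f) (hA3 : A3 f)
    {X U : Set (Ed d)} (hX : IsCompact X) (hU : IsOpen U) (hXU : X ⊆ U) {ψ : Ed d → ℝ}
    (hψ : ContinuousOn ψ U) (hvisc : IsViscSupersol f 1 ψ U)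
    {μ ν : Measure (Ed d)} [IsFiniteMeasure μ] [IsFiniteMeasure ν]
    (hμX : μ Xᶜ = 0) (hνX : ν Xᶜ = 0) :
    ENNReal.ofReal (∫ x, ψ x ∂ν - ∫ x, ψ x ∂μ) ≤ Fstat f X μ ν := by
  obtain ⟨R, hR, hRU⟩ := hX.exists_cthickening_subset_open hU hXU
  have hKc : IsCompact (Metric.cthickening R X) := hX.cthickening
  obtain ⟨ψt, hc, hs, heq⟩ : ∃ ψt : Ed d → ℝ, Continuous ψt ∧ HasCompactSupport ψt ∧
      ∀ x ∈ Metric.cthickening R X, ψt x = ψ x := by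
    obtain ⟨G, hG⟩ := ContinuousMap.exists_restrict_eq (Y := ℝ) hKc.isClosed
      ⟨_, (hψ.mono hRU).domRestrict⟩
    obtain ⟨B, hB⟩ := hKc.isBounded.subset_closedBall (0 : Ed d)
    let χ : ContDiffBump (0 : Ed d) := ⟨max B 1, max B 1 + 1, by positivity, by linarith⟩
    refine ⟨fun x => χ x * G x, χ.continuous.mul G.continuous, χ.hasCompactSupport.mul_right, ?_⟩
    intro x hx
    have h1 : χ x = 1 := χ.one_of_mem_closedBall
      (Metric.closedBall_subset_closedBall (le_max_left B 1) (hB hx))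
    have h2 := congrArg (fun g => g ⟨x, hx⟩) hG
    simp only [ContinuousMap.restrict_apply] at h2
    show χ x * G x = ψ x
    rw [h1, one_mul]
    exact h2
  have hXK : X ⊆ Metric.cthickening R X := Metric.self_subset_cthickening X
  have hint : ∀ m : Measure (Ed d), m Xᶜ = 0 → ∫ x, ψ x ∂m = ∫ x, ψt x ∂m := fun m hm => by
    refine integral_congr_ae ?_
    filter_upwards [ae_mem_X hm] with x hx
    exact (heq x (hXK hx)).symm
  rw [hint ν hνX, hint μ hμX]
  by_cases ht : Fstat f X μ ν = ⊤
  · rw [ht]; exact le_top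
  rw [ENNReal.ofReal_le_iff_le_toReal ht]
  set m := ν.real univ + μ.real univ with hm
  have hm0 : 0 ≤ m := by positivity
  refine le_of_forall_pos_le_add fun ε hε => ?_
  set τ := ε / (m + 1) with hτ
  have hτ0 : 0 < τ := by positivity
  obtain ⟨δ, hδ, hunif⟩ := Metric.uniformContinuous_iff.1 (hs.uniformContinuous_of_continuous hc) τ hτ0
  set r := min δ (R / 4) with hr
  have hr0 : 0 < r := by positivity
  let φ : ContDiffBump (0 : Ed d) := ⟨r / 2, r, by positivity, by linarith⟩
  have hclose : ∀ x, |moll φ ψt x - ψt x| ≤ τ := fun x => moll_close φ hc fun y hy => by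
    have := hunif (a := y) (b := x) (lt_of_lt_of_le hy (min_le_left _ _))
    rw [Real.dist_eq] at this; exact this.le
  have hC := moll_C2c φ hc hs
  have hadm : Adm f X (moll φ ψt) := by
    refine ⟨hC, fun x hx M hM => ?_⟩
    refine kset_of_posdef hd hA1 hA3 (fun N hN hfN => ?_) hM
    have hb : Metric.closedBall x R ⊆ Metric.cthickening R X := Metric.closedBall_subset_cthickening hx R
    refine visc_adm hd hU hvisc hR (hb.trans hRU) hc hs (fun y hy => heq y (hb hy)) φ ?_ N hN hfN
    have : r ≤ R / 4 := min_le_right _ _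
    show r < R / 2
    linarith
  have hwd := weak_duality hA1 (μ := μ) (ν := ν) hadm
  rw [ENNReal.ofReal_le_iff_le_toReal ht] at hwd
  have hest : ∀ (n : Measure (Ed d)) [IsFiniteMeasure n],
      |∫ x, moll φ ψt x ∂n - ∫ x, ψt x ∂n| ≤ τ * n.real univ := fun n _ => by
    rw [← integral_sub (integrable_C2c hC n) (hc.integrable_of_hasCompactSupport hs)]
    exact norm_integral_le_of_norm_le_const (μ := n)
      (f := fun x => moll φ ψt x - ψt x) (Eventually.of_forall fun x => hclose x)
  have a1 := hest μ
  have a2 := hest ν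
  rw [abs_le] at a1 a2
  have : τ * m ≤ ε := by
    rw [hτ, div_mul_eq_mul_div, div_le_iff₀ (by positivity)]
    nlinarith
  rw [hm, mul_add] at this
  linarith [a1.1, a1.2, a2.1, a2.2]

end partW

open MeasureTheory Set Filter Topology
open scoped ENNReal NNReal Classical

section partQ
variable {d : ℕ}

theorem adm_D2 {f : Matd d → ℝ≥0∞} (hA1 : CostA1 f) {k : ℝ} (hk : 0 < k)
    (hk2 : ∀ A : Matd d, A.PosSemidef → f A ≤ ENNReal.ofReal (k * A.trace))
    {X : Set (Ed d)} {g : Ed d → ℝ} (hg : Adm f X g) {x : Ed d} (hx : x ∈ X) (v : Ed d) :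
    D2 g v x ≤ 2 * (k * ‖v‖ ^ 2) := by
  have h1 := adm_scale hA1 ((1/2 : ℝ) • hess g x) (fun M hM =>
    (frob_smul_left _ _ M).le.trans (hg.2 x hx M hM)) (Matrix.vecMulVec v v)
  have hp : (Matrix.vecMulVec v v : Matd d).PosSemidef := by
    simpa using Matrix.posSemidef_vecMulVec_self_star (v : Fin d → ℝ)
  have h2 := h1.trans (hk2 _ hp)
  have h3 : (Matrix.vecMulVec v v : Matd d).trace = ‖v‖ ^ 2 := by
    rw [EuclideanSpace.real_norm_sq_eq]
    simp [Matrix.trace, Matrix.vecMulVec_apply, sq]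
  rw [h3, ENNReal.ofReal_le_ofReal_iff (by positivity), frob_smul_left, hess_quad] at h2
  unfold D2
  linarith

theorem adm_semiconcave {f : Matd d → ℝ≥0∞} (hA1 : CostA1 f) {k : ℝ} (hk : 0 < k)
    (hk2 : ∀ A : Matd d, A.PosSemidef → f A ≤ ENNReal.ofReal (k * A.trace))
    {X Ω : Set (Ed d)} (hΩ : Convex ℝ Ω) (hΩX : Ω ⊆ X) {g : Ed d → ℝ} (hg : Adm f X g)
    {x y : Ed d} (hx : x ∈ Ω) (hy : y ∈ Ω) {a b : ℝ} (ha : 0 ≤ a) (hb : 0 ≤ b) (hab : a + b = 1) :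
    a * (g x - k * ‖x‖ ^ 2) + b * (g y - k * ‖y‖ ^ 2) ≤
      g (a • x + b • y) - k * ‖a • x + b • y‖ ^ 2 := by
  set u := y - x with hu
  let p : ℝ → ℝ := fun s => g (x + s • u) - k * ‖u‖ ^ 2 * s ^ 2
  have hp1 : ∀ s, HasDerivAt p (fderiv ℝ g (x + s • u) u - k * ‖u‖ ^ 2 * (2 * s)) s := fun s => by
    have h3 := (hasDerivAt_pow 2 s).const_mul (k * ‖u‖ ^ 2)
    refine ((D2_line hg.1.1 x u s).1.sub h3).congr_deriv ?_
    simp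
  have hd1 : deriv p = fun s => fderiv ℝ g (x + s • u) u - k * ‖u‖ ^ 2 * (2 * s) :=
    funext fun s => (hp1 s).deriv
  have hp2 : ∀ s, HasDerivAt (deriv p) (D2 g u (x + s • u) - k * ‖u‖ ^ 2 * 2) s := fun s => by
    rw [hd1]
    have h3 := ((hasDerivAt_id s).const_mul 2).const_mul (k * ‖u‖ ^ 2)
    refine ((D2_line hg.1.1 x u s).2.sub h3).congr_deriv ?_
    simp
  have hconc : ConcaveOn ℝ (Icc (0:ℝ) 1) p := by
    refine concaveOn_of_deriv2_nonpos' (convex_Icc 0 1)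
      (fun s _ => (hp1 s).differentiableAt.differentiableWithinAt)
      (fun s _ => (hp2 s).differentiableAt.differentiableWithinAt) ?_
    intro s hs
    have : deriv^[2] p s = D2 g u (x + s • u) - k * ‖u‖ ^ 2 * 2 := (hp2 s).deriv
    rw [this]
    have hz : x + s • u ∈ Ω := by
      have := hΩ hx hy (sub_nonneg.2 hs.2) hs.1 (by ring)
      convert this using 1
      rw [hu, smul_sub, sub_smul, one_smul]; abel
    have := adm_D2 hA1 hk hk2 hg (hΩX hz) u
    linarith
  have key := hconc.2 (x := 0) ⟨le_rfl, zero_le_one⟩ (y := 1) ⟨zero_le_one, le_rfl⟩ ha hb hab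
  simp only [smul_eq_mul, mul_zero, zero_add, mul_one, p] at key
  have e1 : x + b • u = a • x + b • y := by
    have : a = 1 - b := by linarith
    rw [this, hu, smul_sub, sub_smul, one_smul]; abel
  have e2 : x + (1:ℝ) • u = y := by rw [hu, one_smul]; abel
  have e3 : x + (0:ℝ) • u = x := by simp
  rw [e1, e2, e3] at key
  have e4 : a * ‖x‖ ^ 2 + b * ‖y‖ ^ 2 - ‖a • x + b • y‖ ^ 2 = a * b * ‖u‖ ^ 2 := by
    rw [hu, ← real_inner_self_eq_norm_sq, ← real_inner_self_eq_norm_sq, ← real_inner_self_eq_norm_sq,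
      ← real_inner_self_eq_norm_sq]
    simp only [inner_add_left, inner_add_right, inner_sub_left, inner_sub_right, inner_smul_left,
      inner_smul_right, real_inner_comm x y]
    have : b = 1 - a := by linarith
    subst this
    simp
    ring
  have e5 : b = b * b + a * b := by
    have : a = 1 - b := by linarith
    rw [this]; ring
  have e6 : k * (a * b * ‖u‖ ^ 2) = k * (a * ‖x‖ ^ 2 + b * ‖y‖ ^ 2 - ‖a • x + b • y‖ ^ 2) := by rw [e4]
  have e7 : k * ‖u‖ ^ 2 * b = k * ‖u‖ ^ 2 * (b * b) + k * (a * b * ‖u‖ ^ 2) := by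
    nth_rewrite 1 [e5]; ring
  nlinarith

theorem second_test {w : Ed d → ℝ} (hw : ContDiff ℝ 2 w) {x0 x1 : Ed d} {a : ℝ}
    (h : ∀ᶠ y in 𝓝 x1, w x1 + a * ‖x1 - x0‖ ^ 2 ≤ w y + a * ‖y - x0‖ ^ 2) (v : Ed d) :
    -(2 * a * ‖v‖ ^ 2) ≤ D2 w v x1 := by
  refine le_of_forall_pos_le_add fun ε hε => ?_
  have hc : Continuous (fun s : ℝ => x1 + s • v) := by fun_prop
  have hcont : ∀ᶠ s in 𝓝 (0:ℝ), |D2 w v (x1 + s • v) - D2 w v x1| ≤ ε / 2 := by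
    have h1 : Tendsto (fun s : ℝ => D2 w v (x1 + s • v)) (𝓝 0) (𝓝 (D2 w v x1)) := by
      have h2 : Continuous (fun s : ℝ => D2 w v (x1 + s • v)) := (D2_continuous hw v).comp hc
      simpa using h2.tendsto 0
    have := h1.eventually (Metric.closedBall_mem_nhds _ (half_pos hε))
    filter_upwards [this] with s hs
    exact hs
  have hm : ∀ᶠ s in 𝓝 (0:ℝ), w x1 + a * ‖x1 - x0‖ ^ 2 ≤ w (x1 + s • v) + a * ‖x1 + s • v - x0‖ ^ 2 := by
    have : Tendsto (fun s : ℝ => x1 + s • v) (𝓝 0) (𝓝 x1) := by simpa using hc.tendsto 0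
    exact this.eventually h
  obtain ⟨r, hr, hball⟩ := Metric.eventually_nhds_iff.1 (hcont.and hm)
  set s := r / 2 with hs
  have hs0 : 0 < s := by positivity
  have hin : ∀ t : ℝ, |t| ≤ s → dist t 0 < r := fun t ht => by
    rw [Real.dist_eq, sub_zero]; linarith
  have ht := taylor_sym hw x1 v hs0.le (fun t ht => (hball (hin t ht)).1)
  have m1 := (hball (hin s (abs_of_pos hs0).le)).2
  have m2 := (hball (hin (-s) (by rw [abs_neg, abs_of_pos hs0]))).2
  have e : ‖x1 + s • v - x0‖ ^ 2 + ‖x1 + (-s) • v - x0‖ ^ 2 = 2 * ‖x1 - x0‖ ^ 2 + 2 * (s ^ 2 * ‖v‖ ^ 2) := by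
    have e1 : x1 + s • v - x0 = (x1 - x0) + s • v := by abel
    have e2 : x1 + (-s) • v - x0 = (x1 - x0) - s • v := by rw [neg_smul]; abel
    have := parallelogram_law_with_norm ℝ (x1 - x0) (s • v)
    rw [e1, e2]
    have e3 : ‖s • v‖ ^ 2 = s ^ 2 * ‖v‖ ^ 2 := by
      rw [norm_smul, mul_pow, Real.norm_eq_abs, sq_abs]
    nlinarith [this, e3]
  have e' := congrArg (fun t => a * t) e
  simp only [mul_add] at e'
  rw [abs_le] at ht
  have : 0 ≤ s ^ 2 * (D2 w v x1 + ε + 2 * a * ‖v‖ ^ 2) := by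
    nlinarith [ht.2]
  have := (mul_nonneg_iff_of_pos_left (by positivity)).1 this
  linarith

end partQ

open MeasureTheory Set Filter Topology
open scoped ENNReal NNReal Classical

section partQ
variable {d : ℕ}

/-- admissible majorants of `φ` -/
abbrev AdmGe (f : Matd d → ℝ≥0∞) (X : Set (Ed d)) (φ : Ed d → ℝ) : Type :=
  {g : Ed d → ℝ // Adm f X g ∧ ∀ y ∈ X, φ y ≤ g y}

/-- smallest supersolution above `φ`. -/
noncomputable def Qf (f : Matd d → ℝ≥0∞) (X : Set (Ed d)) (φ : Ed d → ℝ) (B : ℝ) (x : Ed d) : ℝ :=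
  ⨅ g : AdmGe f X φ, max (g.1 x) (-B)

variable {f : Matd d → ℝ≥0∞} {X : Set (Ed d)} {φ : Ed d → ℝ} {B : ℝ}

theorem adm_const (f : Matd d → ℝ≥0∞) (hX : IsCompact X) (B : ℝ) :
    ∃ g, Adm f X g ∧ ∀ y ∈ X, g y = B := by
  obtain ⟨R, hR⟩ := hX.isBounded.subset_ball (0 : Ed d)
  let χ : ContDiffBump (0 : Ed d) := ⟨max R 1, max R 1 + 1, by positivity, by linarith⟩
  have h1 : ∀ y ∈ Metric.ball (0 : Ed d) R, χ y = 1 := fun y hy => χ.one_of_mem_closedBall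
    (Metric.ball_subset_closedBall (Metric.ball_subset_ball (le_max_left R 1) hy))
  have hC : IsC2c (fun x => B * χ x) := by
    refine ⟨contDiff_const.mul χ.contDiff, χ.hasCompactSupport.mul_left⟩
  refine ⟨fun x => B * χ x, ⟨hC, fun x hx M hM => ?_⟩, fun y hy => by simp [h1 y (hR hy)]⟩
  have he : (fun x => B * χ x) =ᶠ[𝓝 x] fun _ => B := by
    filter_upwards [Metric.isOpen_ball.mem_nhds (hR hx)] with y hy
    simp [h1 y hy]
  have hz : hess (fun _ : Ed d => B) x = 0 := by
    ext i j
    unfold hess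
    rw [iteratedFDeriv_const_of_ne (by norm_num)]; rfl
  rw [hess_congr he, hz]
  simp [frob]

theorem Qf_bddBelow (x : Ed d) : BddBelow (range fun g : AdmGe f X φ => max (g.1 x) (-B)) :=
  ⟨-B, by rintro _ ⟨g, rfl⟩; exact le_max_right _ _⟩

theorem admGe_nonempty (hX : IsCompact X) (hB : ∀ x, |φ x| ≤ B) : Nonempty (AdmGe f X φ) := by
  obtain ⟨g, h1, h2⟩ := adm_const f hX B
  exact ⟨⟨g, h1, fun y hy => by rw [h2 y hy]; exact (le_abs_self _).trans (hB y)⟩⟩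

theorem Qf_le (hB : ∀ x, |φ x| ≤ B) {g : Ed d → ℝ} (hg : Adm f X g) (hge : ∀ y ∈ X, φ y ≤ g y)
    {x : Ed d} (hx : x ∈ X) : Qf f X φ B x ≤ g x := by
  refine (ciInf_le (Qf_bddBelow x) ⟨g, hg, hge⟩).trans ?_
  refine max_le le_rfl ?_
  have := hge x hx
  have := (abs_le.1 (hB x)).1
  linarith

theorem le_Qf (hX : IsCompact X) (hB : ∀ x, |φ x| ≤ B) {x : Ed d} (c : ℝ)
    (h : ∀ g, Adm f X g → (∀ y ∈ X, φ y ≤ g y) → c ≤ g x) : c ≤ Qf f X φ B x := by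
  have := admGe_nonempty (f := f) hX hB
  exact le_ciInf fun g => (h g.1 g.2.1 g.2.2).trans (le_max_left _ _)

theorem Qf_ge (hX : IsCompact X) (hB : ∀ x, |φ x| ≤ B) {x : Ed d} (hx : x ∈ X) : φ x ≤ Qf f X φ B x :=
  le_Qf hX hB _ fun _ _ h => h x hx

theorem Qf_abs (hX : IsCompact X) (hB : ∀ x, |φ x| ≤ B) {x : Ed d} (hx : x ∈ X) :
    |Qf f X φ B x| ≤ B := by
  rw [abs_le]
  constructor
  · exact (abs_le.1 (hB x)).1.trans (Qf_ge hX hB hx)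
  · obtain ⟨g, h1, h2⟩ := adm_const f hX B
    have := Qf_le hB h1 (fun y hy => by rw [h2 y hy]; exact (le_abs_self _).trans (hB y)) hx
    rwa [h2 x hx] at this

theorem Qf_usc : UpperSemicontinuous (Qf f X φ B) := by
  refine upperSemicontinuous_ciInf Qf_bddBelow fun g => ?_
  exact (g.2.1.1.1.continuous.max continuous_const).upperSemicontinuous

theorem Qf_continuousOn (hA1 : CostA1 f) (hA3 : A3 f) (hX : IsCompact X) (hB : ∀ x, |φ x| ≤ B)
    {Ω : Set (Ed d)} (hΩo : IsOpen Ω) (hΩ : Convex ℝ Ω) (hΩX : Ω ⊆ X) :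
    ContinuousOn (Qf f X φ B) Ω := by
  obtain ⟨k, hk, hk2⟩ := hA3.2
  have hconc : ConcaveOn ℝ Ω (fun x => Qf f X φ B x - k * ‖x‖ ^ 2) := by
    refine ⟨hΩ, fun x hx y hy a b ha hb hab => ?_⟩
    simp only [smul_eq_mul]
    have hz := hΩ hx hy ha hb hab
    rw [le_sub_iff_add_le]
    refine le_Qf hX hB _ fun g hg hge => ?_
    have h1 := adm_semiconcave hA1 hk hk2 hΩ hΩX hg hx hy ha hb hab
    have h2 := mul_le_mul_of_nonneg_left (Qf_le hB hg hge (hΩX hx)) ha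
    have h3 := mul_le_mul_of_nonneg_left (Qf_le hB hg hge (hΩX hy)) hb
    linarith
  have h1 := hconc.continuousOn hΩo
  have h2 : ContinuousOn (fun x : Ed d => k * ‖x‖ ^ 2) Ω := by fun_prop
  refine (h1.add h2).congr fun x _ => ?_
  simp

theorem Qf_visc (hX : IsCompact X) (hB : ∀ x, |φ x| ≤ B)
    {Ω : Set (Ed d)} (hΩo : IsOpen Ω) (hΩX : Ω ⊆ X) :
    IsViscSupersol f 1 (Qf f X φ B) Ω := by
  intro φt hφt x0 hx0 hmin
  refine sSup_le ?_
  rintro _ ⟨M, hM, hfM, rfl⟩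
  rw [EReal.coe_le_coe_iff, frob_smul_left]
  -- globalize the test function
  obtain ⟨r0, hr0, hball⟩ := Metric.isOpen_iff.1 hΩo x0 hx0
  let χ : ContDiffBump x0 := ⟨r0 / 4, r0 / 2, by positivity, by linarith⟩
  let φ' : Ed d → ℝ := fun x => χ x * φt x
  have hφ' : ContDiff ℝ 2 φ' := by
    rw [contDiff_iff_contDiffAt]
    intro x
    by_cases hx : x ∈ tsupport χ
    · rw [χ.tsupport_eq] at hx
      have hxΩ : x ∈ Ω := hball (Metric.closedBall_subset_ball (by show r0 / 2 < r0; linarith) hx)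
      exact χ.contDiffAt.mul (hφt.contDiffAt (hΩo.mem_nhds hxΩ))
    · have : φ' =ᶠ[𝓝 x] fun _ => 0 := by
        filter_upwards [(isClosed_tsupport χ).isOpen_compl.mem_nhds hx] with y hy
        simp only [φ', image_eq_zero_of_notMem_tsupport hy, zero_mul]
      exact contDiffAt_const.congr_of_eventuallyEq this
  have heq : φ' =ᶠ[𝓝 x0] φt := by
    filter_upwards [χ.eventuallyEq_one] with y hy
    simp [φ', hy]
  rw [← hess_congr heq]
  have hmin' : ∀ᶠ y in 𝓝 x0, Qf f X φ B x0 - φ' x0 ≤ Qf f X φ B y - φ' y := by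
    have h1 : ∀ᶠ y in 𝓝 x0, Qf f X φ B x0 - φt x0 ≤ Qf f X φ B y - φt y := by
      have : 𝓝[Ω] x0 = 𝓝 x0 := hΩo.nhdsWithin_eq hx0
      rw [← this]; exact hmin
    filter_upwards [h1, heq] with y h2 h3
    rw [h3, heq.eq_of_nhds]; exact h2
  obtain ⟨v, hv⟩ := psd_decomp hM.posSemidef
  have hdec : ∀ w x, frob (hess w x) M = ∑ k, D2 w (v k) x := fun w x => by
    rw [hv]; exact frob_hess_decomp w x v
  set S := ∑ k, ‖v k‖ ^ 2 with hS
  have hS0 : 0 ≤ S := by positivity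
  refine le_of_forall_pos_le_add fun ε hε => ?_
  set a := ε / (2 * (S + 1)) with ha
  have ha0 : 0 < a := by positivity
  have haS : a * S ≤ ε / 2 := by
    rw [ha, div_mul_eq_mul_div, div_le_iff₀ (by positivity)]
    nlinarith
  have hcont : ∀ᶠ y in 𝓝 x0, (1/2 : ℝ) * frob (hess φ' x0) M ≤ (1/2) * frob (hess φ' y) M + ε / 2 := by
    have h1 : Continuous (fun y => (1/2 : ℝ) * frob (hess φ' y) M + ε / 2) := by
      simp_rw [hdec]
      exact (continuous_const.mul (continuous_finsetSum _ fun k _ => D2_continuous hφ' (v k))).add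
        continuous_const
    have := h1.continuousAt.eventually (lt_mem_nhds
      (show (1/2 : ℝ) * frob (hess φ' x0) M < (1/2) * frob (hess φ' x0) M + ε / 2 by linarith))
    filter_upwards [this] with y hy using hy.le
  obtain ⟨r', hr', hb'⟩ := Metric.eventually_nhds_iff.1
    ((hmin'.and hcont).and (hΩo.mem_nhds hx0))
  set r := r' / 2 with hr
  have hr0' : 0 < r := by positivity
  have hbb : ∀ y ∈ Metric.closedBall x0 r, dist y x0 < r' := fun y hy => by
    rw [Metric.mem_closedBall] at hy; linarith
  -- near optimal g
  have : Nonempty (AdmGe f X φ) := admGe_nonempty hX hB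
  obtain ⟨g, hg⟩ := exists_lt_of_ciInf_lt (f := fun g : AdmGe f X φ => max (g.1 x0) (-B))
    (show (⨅ g : AdmGe f X φ, max (g.1 x0) (-B)) < Qf f X φ B x0 + a * r ^ 2 by
      have : 0 < a * r ^ 2 := by positivity
      unfold Qf; linarith)
  have hg0 : g.1 x0 < Qf f X φ B x0 + a * r ^ 2 := (le_max_left _ _).trans_lt hg
  have hgC := g.2.1.1.1
  let w : Ed d → ℝ := fun y => g.1 y + (-1 : ℝ) * φ' y
  have hwC : ContDiff ℝ 2 w := hgC.add (contDiff_const.mul hφ')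
  obtain ⟨x1, hx1, hmin1⟩ := (isCompact_closedBall x0 r).exists_isMinOn
    ⟨x0, Metric.mem_closedBall_self hr0'.le⟩
    (f := fun y => w y + a * ‖y - x0‖ ^ 2) (by
      have := hwC.continuous
      fun_prop)
  have hx1b : x1 ∈ Metric.ball x0 r := by
    by_contra hc
    rw [Metric.mem_ball] at hc
    push Not at hc
    have hd1 : ‖x1 - x0‖ = r := by
      rw [← dist_eq_norm]; exact le_antisymm hx1 hc
    have h1 : w x1 + a * ‖x1 - x0‖ ^ 2 ≤ w x0 + a * ‖x0 - x0‖ ^ 2 :=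
      hmin1 (Metric.mem_closedBall_self hr0'.le)
    have h2 := (hb' (hbb x1 hx1)).1.1
    have h3 := Qf_le hB g.2.1 g.2.2 (hΩX (hb' (hbb x1 hx1)).2)
    rw [hd1] at h1
    simp only [sub_self, norm_zero, w] at h1
    linarith
  have htest := fun k => second_test hwC (x0 := x0) (x1 := x1) (a := a) (by
    filter_upwards [Metric.isOpen_ball.mem_nhds hx1b] with y hy
    exact hmin1 (Metric.ball_subset_closedBall hy)) (v k)
  have hD : ∀ k, D2 w (v k) x1 = D2 g.1 (v k) x1 + (-1) * D2 φ' (v k) x1 := fun k => by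
    have e : w = g.1 + (-1 : ℝ) • φ' := by ext y; simp [w]
    have h2 : ContDiff ℝ 2 ((-1 : ℝ) • φ') := contDiff_const.smul hφ'
    have h3 := D2_add hgC h2 (v k) x1
    rw [e]
    refine h3.trans ?_
    rw [D2_const_smul hφ']
  have hsum : ∑ k, D2 φ' (v k) x1 ≤ ∑ k, D2 g.1 (v k) x1 + 2 * a * S := by
    rw [hS, Finset.mul_sum, ← Finset.sum_add_distrib]
    refine Finset.sum_le_sum fun k _ => ?_
    have := htest k
    rw [hD] at this
    linarith
  rw [← hdec, ← hdec] at hsum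
  have hK := g.2.1.2 x1 (hΩX (hb' (hbb x1 hx1)).2) M (by
    show f M ≤ 1
    rw [hfM])
  have := (hb' (hbb x1 hx1)).1.2
  linarith

end partQ

open MeasureTheory Set Filter Topology
open scoped ENNReal NNReal Classical

section partD
variable {d : ℕ}

theorem adm_add_const {f : Matd d → ℝ≥0∞} {X : Set (Ed d)} (hX : IsCompact X) {g : Ed d → ℝ}
    (hg : Adm f X g) (B : ℝ) : ∃ g', Adm f X g' ∧ ∀ y ∈ X, g' y = g y + B := by
  obtain ⟨R, hR⟩ := hX.isBounded.subset_ball (0 : Ed d)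
  let χ : ContDiffBump (0 : Ed d) := ⟨max R 1, max R 1 + 1, by positivity, by linarith⟩
  have h1 : ∀ y ∈ Metric.ball (0 : Ed d) R, χ y = 1 := fun y hy => χ.one_of_mem_closedBall
    (Metric.ball_subset_closedBall (Metric.ball_subset_ball (le_max_left R 1) hy))
  have hC : IsC2c (fun x => B * χ x) := by
    refine ⟨contDiff_const.mul χ.contDiff, χ.hasCompactSupport.mul_left⟩
  refine ⟨g + fun x => B * χ x, ⟨⟨hg.1.1.add hC.1, hg.1.2.add hC.2⟩, fun x hx M hM => ?_⟩,
    fun y hy => by simp [h1 y (hR hy)]⟩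
  have he : (fun x => B * χ x) =ᶠ[𝓝 x] fun _ => B := by
    filter_upwards [Metric.isOpen_ball.mem_nhds (hR hx)] with y hy
    simp [h1 y hy]
  have hz : hess (fun _ : Ed d => B) x = 0 := by
    ext i j
    unfold hess
    rw [iteratedFDeriv_const_of_ne (by norm_num)]; rfl
  rw [hess_add hg.1.1.contDiffAt hC.1.contDiffAt, hess_congr he, hz, add_zero]
  exact hg.2 x hx M hM

/-- indicator of `true` -/
def epsB (b : Bool) : ℝ := if b then 1 else 0

theorem continuous_epsB : Continuous epsB := continuous_of_discreteTopology

theorem split_false {Z : Type*} [TopologicalSpace Z] [MeasurableSpace Z] [OpensMeasurableSpace Z]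
    (θ : Measure (Z × Bool)) (F : C(Z, ℝ)) :
    ∫ p, (1 - epsB p.2) * F p.1 ∂θ =
      ∫ z, F z ∂((θ.restrict (Prod.snd ⁻¹' {false})).map Prod.fst) := by
  rw [integral_map measurable_fst.aemeasurable F.continuous.measurable.aestronglyMeasurable,
    ← integral_indicator (measurable_snd (MeasurableSet.singleton _))]
  congr 1; ext ⟨z, b⟩
  cases b <;> simp [epsB, indicator]

theorem split_true {Z : Type*} [TopologicalSpace Z] [MeasurableSpace Z] [OpensMeasurableSpace Z]
    (θ : Measure (Z × Bool)) (F : C(Z, ℝ)) :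
    ∫ p, epsB p.2 * F p.1 ∂θ =
      ∫ z, F z ∂((θ.restrict (Prod.snd ⁻¹' {true})).map Prod.fst) := by
  rw [integral_map measurable_fst.aemeasurable F.continuous.measurable.aestronglyMeasurable,
    ← integral_indicator (measurable_snd (MeasurableSet.singleton _))]
  congr 1; ext ⟨z, b⟩
  cases b <;> simp [epsB, indicator]

/-- evaluation of differences and hessians -/
noncomputable def Lmap (f : Matd d → ℝ≥0∞) (X : Set (Ed d)) :
    C2c d →ₗ[ℝ] C((X × X × Kset f) × Bool, ℝ) where
  toFun g := ⟨fun p => epsB p.2 * hessT f g (p.1.2.1.1, p.1.2.2)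
      - (1 - epsB p.2) * (g.1 p.1.2.1.1 - g.1 p.1.1.1), by
    have h1 := continuous_epsB
    have h2 := (hessT f g).continuous
    have h3 := g.2.1.continuous
    fun_prop⟩
  map_add' g h := by
    ext p
    simp only [map_add, ContinuousMap.coe_mk, ContinuousMap.add_apply, Submodule.coe_add, Pi.add_apply]
    ring
  map_smul' c g := by
    ext p
    simp only [map_smul, ContinuousMap.coe_mk, ContinuousMap.smul_apply, Submodule.coe_smul,
      Pi.smul_apply, smul_eq_mul, RingHom.id_apply]
    ring

abbrev BC (d : ℕ) := BoundedContinuousFunction (Ed d) ℝ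

/-- localised version -/
noncomputable def Lloc (f : Matd d → ℝ≥0∞) (X : Set (Ed d)) :
    ((BC d × C2c d) →₀ ℝ) →ₗ[ℝ] C((X × X × Kset f) × Bool, ℝ) :=
  Finsupp.linearCombination ℝ fun q : BC d × C2c d =>
    (⟨fun p => q.1 p.1.1.1 * Lmap f X q.2 p, by
      have h1 := q.1.continuous
      have h2 := (Lmap f X q.2).continuous
      fun_prop⟩ : C((X × X × Kset f) × Bool, ℝ))

noncomputable def evL (x0 : Ed d) : ((BC d × C2c d) →₀ ℝ) →ₗ[ℝ] C2c d :=
  Finsupp.linearCombination ℝ fun q : BC d × C2c d => q.1 x0 • q.2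

theorem Lloc_eq (f : Matd d → ℝ≥0∞) (X : Set (Ed d)) (b : (BC d × C2c d) →₀ ℝ)
    (p : (X × X × Kset f) × Bool) : Lloc f X b p = Lmap f X (evL p.1.1.1 b) p := by
  induction b using Finsupp.induction_linear with
  | zero => simp
  | add a b ha hb => simp only [map_add, ContinuousMap.add_apply, ha, hb]
  | single q c =>
    simp only [Lloc, evL, Finsupp.linearCombination_single, map_smul, ContinuousMap.smul_apply]
    rfl

noncomputable def PhiMap (f : Matd d → ℝ≥0∞) (X : Set (Ed d)) :
    BC d →ₗ[ℝ] C((X × X × Kset f) × Bool, ℝ) where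
  toFun φ := ⟨fun p => (1 - epsB p.2) * φ p.1.2.1.1, by
    have h1 := continuous_epsB
    have h3 := φ.continuous
    fun_prop⟩
  map_add' g h := by
    ext p
    simp only [ContinuousMap.coe_mk, ContinuousMap.add_apply, BoundedContinuousFunction.add_apply]
    ring
  map_smul' c g := by
    ext p
    simp only [ContinuousMap.coe_mk, ContinuousMap.smul_apply, BoundedContinuousFunction.smul_apply,
      smul_eq_mul, RingHom.id_apply]
    ring

noncomputable def AlMap (f : Matd d → ℝ≥0∞) (X : Set (Ed d)) :
    BC d →ₗ[ℝ] C((X × X × Kset f) × Bool, ℝ) where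
  toFun φ := ⟨fun p => (1 - epsB p.2) * φ p.1.1.1, by
    have h1 := continuous_epsB
    have h3 := φ.continuous
    fun_prop⟩
  map_add' g h := by
    ext p
    simp only [ContinuousMap.coe_mk, ContinuousMap.add_apply, BoundedContinuousFunction.add_apply]
    ring
  map_smul' c g := by
    ext p
    simp only [ContinuousMap.coe_mk, ContinuousMap.smul_apply, BoundedContinuousFunction.smul_apply,
      smul_eq_mul, RingHom.id_apply]
    ring

noncomputable def intBC (μ : Measure (Ed d)) [IsFiniteMeasure μ] : BC d →ₗ[ℝ] ℝ where
  toFun φ := ∫ x, φ x ∂μ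
  map_add' φ ψ := integral_add (φ.integrable μ) (ψ.integrable μ)
  map_smul' c φ := integral_const_mul c φ

theorem Qf_integrable {f : Matd d → ℝ≥0∞} {X : Set (Ed d)} (hX : IsCompact X) {φ : Ed d → ℝ} {B : ℝ}
    (hB : ∀ x, |φ x| ≤ B) {μ : Measure (Ed d)} [IsFiniteMeasure μ] (hμX : μ Xᶜ = 0) :
    Integrable (Qf f X φ B) μ := by
  refine Integrable.of_bound (Qf_usc).measurable.aestronglyMeasurable B ?_
  filter_upwards [ae_mem_X hμX] with x hx
  exact Qf_abs hX hB hx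

theorem exists_plan {f : Matd d → ℝ≥0∞} (hA1 : CostA1 f) (hA2 : CostA2 f)
    {X : Set (Ed d)} (hX : IsCompact X) {μ ν : Measure (Ed d)} [IsFiniteMeasure μ]
    [IsFiniteMeasure ν] (hμX : μ Xᶜ = 0) (hνX : ν Xᶜ = 0) (D : ℝ) (hD : 0 ≤ D)
    (hQ : ∀ φ : BC d, ∫ x, Qf f X φ ‖φ‖ x ∂ν - ∫ x, Qf f X φ ‖φ‖ x ∂μ ≤ D) :
    ∃ (γ : Measure (Ed d × X)) (Θ : Measure (Ed d × (X × Kset f))),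
      IsFiniteMeasure γ ∧ IsFiniteMeasure Θ ∧ Θ univ ≤ ENNReal.ofReal D ∧
      (∀ φ : BC d, ∫ p, φ p.2.1 ∂γ = ∫ y, φ y ∂ν) ∧
      (∀ φ : BC d, ∫ p, φ p.1 ∂γ = ∫ y, φ y ∂μ) ∧
      (∀ (a : BC d) (g : C2c d), ∫ p, a p.1 * hessT f g (p.2.1.1, p.2.2) ∂Θ =
        ∫ p, a p.1 * (g.1 p.2.1 - g.1 p.1) ∂γ) := by
  have : CompactSpace X := isCompact_iff_compactSpace.1 hX
  have : CompactSpace (Kset f) := isCompact_iff_compactSpace.1 (Kset_compact hA1 hA2)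
  let T : (BC d × BC d × ((BC d × C2c d) →₀ ℝ)) →ₗ[ℝ] C((X × X × Kset f) × Bool, ℝ) :=
    (PhiMap f X).coprod ((AlMap f X).coprod (Lloc f X))
  let ℓ : (BC d × BC d × ((BC d × C2c d) →₀ ℝ)) →ₗ[ℝ] ℝ :=
    (intBC ν).coprod ((intBC μ).coprod 0)
  obtain ⟨θ, hfin, hmass, hθ⟩ := hb_rmk T ℓ (μ.real univ + D) (by positivity) (by
    rintro ⟨φ, α, b⟩ hT
    have hT' : ∀ p : (X × X × Kset f) × Bool, (1 - epsB p.2) * φ p.1.2.1.1 +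
      ((1 - epsB p.2) * α p.1.1.1 + (epsB p.2 * hessT f (evL p.1.1.1 b) (p.1.2.1.1, p.1.2.2)
      - (1 - epsB p.2) * ((evL p.1.1.1 b).1 p.1.2.1.1 - (evL p.1.1.1 b).1 p.1.1.1))) ≤ 1 := by
      intro p
      have h1 := hT p
      have h2 := Lloc_eq f X b p
      have h3 : T (φ, α, b) p = (1 - epsB p.2) * φ p.1.2.1.1 + ((1 - epsB p.2) * α p.1.1.1 +
        Lloc f X b p) := rfl
      rw [h3, h2] at h1
      exact h1
    have hB : ∀ x, |φ x| ≤ ‖φ‖ := fun x => φ.norm_coe_le_norm x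
    have hα : ∀ x ∈ X, α x ≤ 1 - Qf f X φ ‖φ‖ x := by
      intro x0 hx0
      have hadm : Adm f X (evL x0 b).1 := ⟨(evL x0 b).2, fun x hx M hM => by
        have := hT' ((⟨x0, hx0⟩, ⟨x, hx⟩, ⟨M, hM⟩), true)
        simpa [epsB, hessT_apply] using this⟩
      obtain ⟨g', hg', hge⟩ := adm_add_const hX hadm (1 - α x0 - (evL x0 b).1 x0)
      have h1 := Qf_le (B := ‖φ‖) (φ := φ) hB hg' (by
        intro y hy
        have := hT' ((⟨x0, hx0⟩, ⟨y, hy⟩, ⟨0, Kset_zero hA1⟩), false)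
        simp only [epsB] at this
        rw [hge y hy]
        norm_num at this
        linarith) hx0
      rw [hge x0 hx0] at h1
      linarith
    have i1 := Qf_integrable (f := f) hX hB hμX
    have i2 := Qf_integrable (f := f) hX hB hνX
    have h1 : ∫ x, φ x ∂ν ≤ ∫ x, Qf f X φ ‖φ‖ x ∂ν := by
      refine integral_mono_ae (φ.integrable ν) i2 ?_
      filter_upwards [ae_mem_X hνX] with x hx using Qf_ge hX hB hx
    have h2 : ∫ x, α x ∂μ ≤ ∫ x, (1 - Qf f X φ ‖φ‖ x) ∂μ := by
      refine integral_mono_ae (α.integrable μ) ((integrable_const _).sub i1) ?_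
      filter_upwards [ae_mem_X hμX] with x hx using hα x hx
    rw [integral_sub (integrable_const _) i1] at h2
    simp only [integral_const, smul_eq_mul, mul_one] at h2
    have h3 := hQ φ
    have h4 : ℓ (φ, α, b) = ∫ x, φ x ∂ν + (∫ x, α x ∂μ + 0) := rfl
    rw [h4]
    linarith)
  have hmi : MeasurableSet (Prod.snd ⁻¹' {false} : Set ((X × X × Kset f) × Bool)) :=
    measurable_snd (MeasurableSet.singleton _)
  have hmi' : MeasurableSet (Prod.snd ⁻¹' {true} : Set ((X × X × Kset f) × Bool)) :=
    measurable_snd (MeasurableSet.singleton _)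
  set θ0 := (θ.restrict (Prod.snd ⁻¹' {false})).map Prod.fst with hθ0
  set θ1 := (θ.restrict (Prod.snd ⁻¹' {true})).map Prod.fst with hθ1
  let i0 : X × X × Kset f → Ed d × X := fun z => (z.1.1, z.2.1)
  let i1 : X × X × Kset f → Ed d × (X × Kset f) := fun z => (z.1.1, z.2)
  have hi0 : Measurable i0 := (by fun_prop : Continuous i0).measurable
  have hi1 : Measurable i1 := (by fun_prop : Continuous i1).measurable
  have hν' : ∀ φ : BC d, ∫ p, φ p.2.1 ∂(θ0.map i0) = ∫ y, φ y ∂ν := by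
    intro φ
    have e1 := hθ (φ, 0, 0)
    rw [integral_map hi0.aemeasurable (by
      exact (by fun_prop : Continuous fun p : Ed d × X => φ p.2.1).aestronglyMeasurable)]
    have e2 := split_false θ (⟨fun z => φ z.2.1.1, by fun_prop⟩ : C(X × X × Kset f, ℝ))
    refine e2.symm.trans ?_
    simp only [ℓ, T, LinearMap.coprod_apply, map_zero, add_zero, LinearMap.zero_apply] at e1
    exact e1.symm
  have hμ' : ∀ φ : BC d, ∫ p, φ p.1 ∂(θ0.map i0) = ∫ y, φ y ∂μ := by
    intro φ
    have e1 := hθ (0, φ, 0)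
    rw [integral_map hi0.aemeasurable (by
      exact (by fun_prop : Continuous fun p : Ed d × X => φ p.1).aestronglyMeasurable)]
    have e2 := split_false θ (⟨fun z => φ z.1.1, by fun_prop⟩ : C(X × X × Kset f, ℝ))
    refine e2.symm.trans ?_
    simp only [ℓ, T, LinearMap.coprod_apply, map_zero, add_zero, LinearMap.zero_apply,
      zero_add] at e1
    exact e1.symm
  refine ⟨θ0.map i0, θ1.map i1, inferInstance, inferInstance, ?_, hν', hμ', ?_⟩
  · have e1 := hμ' (BoundedContinuousFunction.const _ 1)
    simp only [BoundedContinuousFunction.const_apply, integral_const, smul_eq_mul, mul_one] at e1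
    have e2 : (θ0.map i0).real univ = θ.real (Prod.snd ⁻¹' {false}) := by
      simp only [Measure.real]
      rw [Measure.map_apply hi0 MeasurableSet.univ, preimage_univ, hθ0,
        Measure.map_apply measurable_fst MeasurableSet.univ, preimage_univ, Measure.restrict_apply_univ]
    have e3 : (θ1.map i1) univ = θ (Prod.snd ⁻¹' {true}) := by
      rw [Measure.map_apply hi1 MeasurableSet.univ, preimage_univ, hθ1,
        Measure.map_apply measurable_fst MeasurableSet.univ, preimage_univ, Measure.restrict_apply_univ]
    have e4 : θ.real univ = θ.real (Prod.snd ⁻¹' {false}) + θ.real (Prod.snd ⁻¹' {true}) := by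
      rw [← measureReal_add_measureReal_compl hmi]
      congr 2
      ext ⟨z, b⟩
      cases b <;> simp
    rw [e3, ← ofReal_measureReal]
    refine ENNReal.ofReal_le_ofReal ?_
    linarith
  · intro a g
    have e1 := hθ (0, 0, Finsupp.single (a, g) 1)
    simp only [ℓ, T, LinearMap.coprod_apply, map_zero, add_zero, LinearMap.zero_apply,
      zero_add, Lloc, Finsupp.linearCombination_single, one_smul] at e1
    have c1 := (hessT f g).continuous
    have c2 := g.2.1.continuous
    rw [integral_map hi0.aemeasurable (by
      exact (by fun_prop : Continuous fun p : Ed d × X =>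
        a p.1 * (g.1 p.2.1 - g.1 p.1)).aestronglyMeasurable),
      integral_map hi1.aemeasurable (by
      exact (by fun_prop : Continuous fun p : Ed d × (X × Kset f) =>
        a p.1 * hessT f g (p.2.1.1, p.2.2)).aestronglyMeasurable)]
    let F0 : C(X × X × Kset f, ℝ) := ⟨fun z => a z.1.1 * (g.1 z.2.1.1 - g.1 z.1.1), by fun_prop⟩
    let F1 : C(X × X × Kset f, ℝ) := ⟨fun z => a z.1.1 * hessT f g (z.2.1.1, z.2.2), by fun_prop⟩
    have s0 := split_false θ F0
    have s1 := split_true θ F1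
    refine s1.symm.trans (Eq.trans ?_ s0)
    have c3 := continuous_epsB
    have hint : ∀ G : (X × X × Kset f) × Bool → ℝ, Continuous G → Integrable G θ := fun G hG =>
      hG.integrable_of_hasCompactSupport (HasCompactSupport.of_compactSpace G)
    rw [← sub_eq_zero, ← integral_sub (hint _ (by fun_prop)) (hint _ (by fun_prop))]
    refine Eq.trans ?_ e1.symm
    congr 1; ext p
    simp only [F0, F1, ContinuousMap.coe_mk, Lmap, LinearMap.coe_mk, AddHom.coe_mk]
    ring

end partD

open MeasureTheory Set Filter Topology
open scoped ENNReal NNReal Classical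

section partE
variable {d : ℕ}

theorem ae_eq_two (σ μ : Measure (Ed d)) [IsFiniteMeasure σ] [IsFiniteMeasure μ] {H K : Ed d → ℝ}
    (hH : StronglyMeasurable H) (hK : StronglyMeasurable K) {C C' : ℝ} (hHC : ∀ x, ‖H x‖ ≤ C)
    (hKC : ∀ x, ‖K x‖ ≤ C')
    (h : ∀ a : BC d, ∫ x, a x * H x ∂σ = ∫ x, a x * K x ∂μ) :
    ∀ᵐ x ∂(σ + μ), (σ.rnDeriv (σ + μ) x).toReal * H x = (μ.rnDeriv (σ + μ) x).toReal * K x := by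
  have hσ : σ ≪ σ + μ := Measure.AbsolutelyContinuous.rfl.add_right μ
  have hμ : μ ≪ σ + μ := by
    rw [add_comm]; exact Measure.AbsolutelyContinuous.rfl.add_right σ
  have := Measure.haveLebesgueDecomposition_of_finiteMeasure (μ := σ) (ν := σ + μ)
  have := Measure.haveLebesgueDecomposition_of_finiteMeasure (μ := μ) (ν := σ + μ)
  refine ae_eq_of_integral_contDiff_smul_eq ?_ ?_ ?_
  · exact (Measure.integrable_toReal_rnDeriv.mul_bdd hH.aestronglyMeasurable
      (Eventually.of_forall hHC)).locallyIntegrable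
  · exact (Measure.integrable_toReal_rnDeriv.mul_bdd hK.aestronglyMeasurable
      (Eventually.of_forall hKC)).locallyIntegrable
  · intro g hg hgc
    obtain ⟨B, hB⟩ := hgc.exists_bound_of_continuous hg.continuous
    have := h (BoundedContinuousFunction.ofNormedAddCommGroup g hg.continuous B hB)
    rw [← integral_rnDeriv_smul hσ, ← integral_rnDeriv_smul hμ] at this
    refine Eq.trans (integral_congr_ae (Eventually.of_forall fun x => ?_)) (this.trans
      (integral_congr_ae (Eventually.of_forall fun x => ?_)))
    · simp; ring
    · simp; ring

theorem continuous_integral_C {Y : Type*} [TopologicalSpace Y] [CompactSpace Y] [MeasurableSpace Y]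
    [BorelSpace Y] (m : Measure Y) [IsFiniteMeasure m] :
    Continuous fun e : C(Y, ℝ) => ∫ y, e y ∂m := by
  have hi : ∀ e : C(Y, ℝ), Integrable e m := fun e =>
    Integrable.of_bound e.continuous.measurable.aestronglyMeasurable ‖e‖
      (Eventually.of_forall fun y => e.norm_coe_le_norm y)
  let L : C(Y, ℝ) →ₗ[ℝ] ℝ :=
    { toFun := fun e => ∫ y, e y ∂m
      map_add' := fun a b => integral_add (hi a) (hi b)
      map_smul' := fun c a => integral_const_mul c a }
  exact (L.mkContinuous (m.real univ) fun e => by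
    refine (norm_integral_le_of_norm_le_const
      (Eventually.of_forall fun y => e.norm_coe_le_norm y)).trans ?_
    rw [mul_comm]).continuous

/-- the joint restriction -/
noncomputable def Jmap (f : Matd d → ℝ≥0∞) (X : Set (Ed d)) (g : C2c d) :
    C(X, ℝ) × C(X × Kset f, ℝ) :=
  (⟨fun x => g.1 x.1, g.2.1.continuous.comp continuous_subtype_val⟩,
    ⟨fun q => hessT f g (q.1.1, q.2), by
      have := (hessT f g).continuous
      fun_prop⟩)

theorem exists_dense_C2c {f : Matd d → ℝ≥0∞} (hA1 : CostA1 f) (hA2 : CostA2 f)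
    {X : Set (Ed d)} (hX : IsCompact X) : ∃ u : ℕ → C2c d,
      ∀ g, Jmap f X g ∈ closure (range fun n => Jmap f X (u n)) := by
  have : CompactSpace X := isCompact_iff_compactSpace.1 hX
  have : CompactSpace (Kset f) := isCompact_iff_compactSpace.1 (Kset_compact hA1 hA2)
  have : Nonempty (range (Jmap f X)) := ⟨⟨_, ⟨0, rfl⟩⟩⟩
  have hd := TopologicalSpace.denseRange_denseSeq (range (Jmap f X))
  choose u hu using fun n => (TopologicalSpace.denseSeq (range (Jmap f X)) n).2
  refine ⟨u, fun g => ?_⟩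
  have h1 := hd ⟨Jmap f X g, ⟨g, rfl⟩⟩
  have h2 := image_closure_subset_closure_image continuous_subtype_val (mem_image_of_mem _ h1)
  convert h2 using 2
  rw [← range_comp]
  congr 1; ext1 n; exact hu n

theorem H_le_of_plan {f : Matd d → ℝ≥0∞} (hA1 : CostA1 f) (hA2 : CostA2 f)
    {X : Set (Ed d)} (hX : IsCompact X) (hne : X.Nonempty) {μ ν : Measure (Ed d)} [IsFiniteMeasure μ]
    [IsFiniteMeasure ν] (hμX : μ Xᶜ = 0)
    (γ : Measure (Ed d × X)) (Θ : Measure (Ed d × (X × Kset f)))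
    [IsFiniteMeasure γ] [IsFiniteMeasure Θ]
    (hν : ∀ φ : BC d, ∫ p, φ p.2.1 ∂γ = ∫ y, φ y ∂ν)
    (hμ : ∀ φ : BC d, ∫ p, φ p.1 ∂γ = ∫ y, φ y ∂μ)
    (hE : ∀ (a : BC d) (g : C2c d), ∫ p, a p.1 * hessT f g (p.2.1.1, p.2.2) ∂Θ =
        ∫ p, a p.1 * (g.1 p.2.1 - g.1 p.1) ∂γ) :
    Hcost f X μ ν ≤ Θ univ := by
  have : CompactSpace X := isCompact_iff_compactSpace.1 hX
  have : CompactSpace (Kset f) := isCompact_iff_compactSpace.1 (Kset_compact hA1 hA2)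
  have : Nonempty X := hne.to_subtype
  have : Nonempty (Kset f) := ⟨⟨0, Kset_zero hA1⟩⟩
  have : StandardBorelSpace X := hX.measurableSet.standardBorel
  have : StandardBorelSpace (Kset f) := (Kset_closed hA2).measurableSet.standardBorel
  have hfst : γ.fst = μ := by
    refine ext_of_forall_integral_eq_of_IsFiniteMeasure fun φ => ?_
    rw [Measure.fst, integral_map measurable_fst.aemeasurable φ.continuous.aestronglyMeasurable]
    exact hμ φ
  have hsnd : γ.map (fun p => p.2.1) = ν := by
    refine ext_of_forall_integral_eq_of_IsFiniteMeasure fun φ => ?_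
    rw [integral_map (by fun_prop) φ.continuous.aestronglyMeasurable]
    exact hν φ
  let κ : Ed d → Measure (Ed d) := fun x => (γ.condKernel x).map Subtype.val
  have hκ : IsTransportKernel X μ ν κ := by
    refine ⟨fun x => ⟨?_, ?_⟩, fun A hA => ?_, fun A hA => ?_⟩
    · exact Measure.isProbabilityMeasure_map measurable_subtype_coe.aemeasurable
    · simp only [κ]
      rw [Measure.map_apply measurable_subtype_coe hX.measurableSet.compl]
      convert measure_empty (μ := γ.condKernel x)
      ext y; simp
    · simp only [κ]
      simp_rw [Measure.map_apply measurable_subtype_coe hA]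
      exact ProbabilityTheory.Kernel.measurable_coe _ (measurable_subtype_coe hA)
    · simp only [κ]
      simp_rw [Measure.map_apply measurable_subtype_coe hA]
      rw [← hsnd, Measure.map_apply (by fun_prop) hA, ← hfst]
      exact Measure.lintegral_condKernel_mem (ρ := γ) (s := (fun p : Ed d × X => p.2.1) ⁻¹' A)
        ((by fun_prop : Measurable fun p : Ed d × X => p.2.1) hA)
  set σ := Θ.fst with hσdef
  set τ := σ + μ with hτ
  set s := σ.rnDeriv τ with hs
  set m := μ.rnDeriv τ with hm
  have hστ : σ ≪ τ := Measure.AbsolutelyContinuous.rfl.add_right μ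
  have hμτ : μ ≪ τ := by
    rw [hτ, add_comm]; exact Measure.AbsolutelyContinuous.rfl.add_right σ
  have := Measure.haveLebesgueDecomposition_of_finiteMeasure (μ := σ) (ν := τ)
  have := Measure.haveLebesgueDecomposition_of_finiteMeasure (μ := μ) (ν := τ)
  let Hg : C2c d → Ed d → ℝ := fun g x => ∫ q, hessT f g (q.1.1, q.2) ∂(Θ.condKernel x)
  let Kg : C2c d → Ed d → ℝ := fun g x => ∫ y, (g.1 y.1 - g.1 x) ∂(γ.condKernel x)
  have hae : ∀ g, ∀ᵐ x ∂τ, (s x).toReal * Hg g x = (m x).toReal * Kg g x := by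
    intro g
    obtain ⟨C, hC⟩ := bounded_frobhess g.2 hA1
    obtain ⟨C', hC'⟩ := g.2.2.exists_bound_of_continuous g.2.1.continuous
    have c1 := (hessT f g).continuous
    have c2 := g.2.1.continuous
    have b1 : ∀ x, ‖Hg g x‖ ≤ C := fun x => by
      refine (norm_integral_le_of_norm_le_const (C := C)
        (Eventually.of_forall fun q => hC q.1.1 q.2)).trans ?_
      simp
    have b2' : ∀ x y, ‖g.1 y - g.1 x‖ ≤ C' + C' := fun x y =>
      (norm_sub_le _ _).trans (add_le_add (hC' y) (hC' x))
    have b2 : ∀ x, ‖Kg g x‖ ≤ C' + C' := fun x => by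
      refine (norm_integral_le_of_norm_le_const (C := C' + C')
        (Eventually.of_forall fun q : X => b2' x q.1)).trans ?_
      simp
    refine ae_eq_two σ μ ?_ ?_ b1 b2 ?_
    · refine StronglyMeasurable.integral_kernel (κ := Θ.condKernel) ?_
      exact (by fun_prop : Continuous fun q : X × Kset f => hessT f g (q.1.1, q.2)).stronglyMeasurable
    · refine StronglyMeasurable.integral_kernel_prod_right (κ := γ.condKernel) ?_
      exact (by fun_prop : Continuous fun p : Ed d × X => g.1 p.2.1 - g.1 p.1).stronglyMeasurable
    · intro a
      have e := hE a g
      rw [← Measure.integral_condKernel, ← Measure.integral_condKernel, hfst] at e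
      · simp only [integral_const_mul] at e
        exact e
      · refine Integrable.of_bound (C := ‖a‖ * (C' + C')) (by fun_prop : Continuous fun p : Ed d × X =>
          a p.1 * (g.1 p.2.1 - g.1 p.1)).aestronglyMeasurable (Eventually.of_forall fun p => ?_)
        rw [norm_mul]
        exact mul_le_mul (a.norm_coe_le_norm _) (b2' _ _) (norm_nonneg _) (norm_nonneg _)
      · refine Integrable.of_bound (C := ‖a‖ * C) (by fun_prop : Continuous fun p : Ed d × (X × Kset f) =>
          a p.1 * hessT f g (p.2.1.1, p.2.2)).aestronglyMeasurable (Eventually.of_forall fun p => ?_)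
        rw [norm_mul]
        exact mul_le_mul (a.norm_coe_le_norm _) (hC _ _) (norm_nonneg _) (norm_nonneg _)
  obtain ⟨u, hu⟩ := exists_dense_C2c hA1 hA2 hX
  have hG : ∀ᵐ x ∂μ, Gcost f X x (κ x) ≤ s x / m x := by
    filter_upwards [hμτ.ae_le (ae_all_iff.2 fun n => hae (u n)), Measure.rnDeriv_pos hμτ,
      hμτ.ae_le (Measure.rnDeriv_lt_top μ τ), hμτ.ae_le (Measure.rnDeriv_lt_top σ τ),
      ae_mem_X hμX] with x h1 h2 h3 h4 hx
    have hsplit : ∀ g : C2c d, Kg g x = ∫ y : X, g.1 y.1 ∂(γ.condKernel x) - g.1 x := fun g => by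
      have c2 := g.2.1.continuous
      simp only [Kg]
      obtain ⟨C', hC'⟩ := g.2.2.exists_bound_of_continuous g.2.1.continuous
      rw [integral_sub (Integrable.of_bound (C := C') (by fun_prop : Continuous fun y : X =>
        g.1 y.1).aestronglyMeasurable (Eventually.of_forall fun y => hC' y.1)) (integrable_const _)]
      simp
    have hall : ∀ g, (s x).toReal * Hg g x = (m x).toReal * Kg g x := by
      intro g
      have hcl : IsClosed {e : C(X, ℝ) × C(X × Kset f, ℝ) |
          (s x).toReal * ∫ q, e.2 q ∂(Θ.condKernel x) =
          (m x).toReal * (∫ y, e.1 y ∂(γ.condKernel x) - e.1 ⟨x, hx⟩)} := by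
        refine isClosed_eq ?_ ?_
        · exact continuous_const.mul ((continuous_integral_C _).comp continuous_snd)
        · refine continuous_const.mul (((continuous_integral_C _).comp continuous_fst).sub ?_)
          exact (continuous_eval_const _).comp continuous_fst
      have := closure_minimal (s := range fun n => Jmap f X (u n)) (by
        rintro _ ⟨n, rfl⟩
        have := h1 n
        rw [hsplit] at this
        exact this) hcl (hu g)
      rw [hsplit]
      exact this
    have hmt : 0 < (m x).toReal := ENNReal.toReal_pos h2.ne' h3.ne
    have hfinc : s x / m x ≠ ⊤ := (ENNReal.div_lt_top h4.ne h2.ne').ne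
    let i : X × Kset f → Ed d × Kset f := fun q => (q.1.1, q.2)
    have hi : Measurable i := (by fun_prop : Continuous i).measurable
    have hfm : IsFiniteMeasure ((s x / m x) • (Θ.condKernel x).map i) :=
      ⟨by simpa using ENNReal.mul_lt_top hfinc.lt_top (measure_lt_top _ _)⟩
    have hle := Fstat_le_of_theta hA1 hA2 hX.measurableSet (μ := Measure.dirac x) (ν := κ x)
      ((s x / m x) • (Θ.condKernel x).map i) (by
        rw [Measure.smul_apply, Measure.map_apply hi (measurable_fst hX.measurableSet.compl)]
        have : i ⁻¹' (Prod.fst ⁻¹' Xᶜ) = ∅ := by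
          ext q; simp [i]
        rw [this]; simp) (by
        intro φ hφ
        rw [integral_smul_measure, integral_map hi.aemeasurable
          (continuous_frobhess hφ.1).aestronglyMeasurable, integral_dirac]
        have e1 := hall ⟨φ, hφ⟩
        rw [hsplit] at e1
        simp only [κ]
        rw [integral_map measurable_subtype_coe.aemeasurable hφ.1.continuous.aestronglyMeasurable,
          smul_eq_mul, ENNReal.toReal_div, div_mul_eq_mul_div, div_eq_iff hmt.ne', mul_comm (_ - _)]
        exact e1)
    refine hle.trans ?_
    rw [Measure.smul_apply, Measure.map_apply hi MeasurableSet.univ, preimage_univ, measure_univ]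
    simp
  refine (show Hcost f X μ ν ≤ _ from sInf_le ⟨κ, hκ, rfl⟩).trans ((lintegral_mono_ae hG).trans ?_)
  rw [← lintegral_rnDeriv_mul hμτ (by
    exact ((Measure.measurable_rnDeriv _ _).div (Measure.measurable_rnDeriv _ _)).aemeasurable)]
  have h5 : σ univ = Θ univ := Measure.fst_univ
  rw [← h5]
  refine le_trans (lintegral_mono fun x => ?_) (Measure.lintegral_rnDeriv_le (μ := σ) (ν := τ))
  exact ENNReal.mul_div_le

end partE


/-- Theorem 4.16. Under (A3), if `μ, ν ∈ M₊(X)` satisfy the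
nonconcentration property on `∂X`, then `F(μ,ν) = H(μ,ν)`. -/
theorem stmt18 {d : ℕ} (hd : 0 < d) (f : Matd d → ℝ≥0∞) (hA1 : CostA1 f) (hA2 : CostA2 f)
    (Ω X : Set (Ed d)) (hΩopen : IsOpen Ω) (hΩconv : Convex ℝ Ω)
    (hΩbdd : Bornology.IsBounded Ω) (hΩne : Ω.Nonempty) (hX : X = closure Ω)
    (hA3 : (∀ M : Matd d, f M ≠ ⊤ ↔ M.PosSemidef) ∧
      ∃ k : ℝ, 0 < k ∧ ∀ A : Matd d, A.PosSemidef → f A ≤ ENNReal.ofReal (k * A.trace))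
    (μ ν : Measure (Ed d)) [IsFiniteMeasure μ] [IsFiniteMeasure ν]
    (hμX : μ Xᶜ = 0) (hνX : ν Xᶜ = 0)
    (hNC : ∃ U : Set (Ed d), IsOpen U ∧ X ⊆ U ∧
      sSup { c : ℝ≥0∞ | ∃ ψ : Ed d → ℝ, (∃ C : ℝ, ∀ x ∈ X, |ψ x| ≤ C) ∧
          UpperSemicontinuousOn ψ X ∧ ContinuousOn ψ Ω ∧ IsViscSupersol f 1 ψ Ω ∧
          c = ENNReal.ofReal (∫ x, ψ x ∂ν - ∫ x, ψ x ∂μ) } =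
        sSup { c : ℝ≥0∞ | ∃ ψ : Ed d → ℝ, ContinuousOn ψ U ∧ IsViscSupersol f 1 ψ U ∧
          c = ENNReal.ofReal (∫ x, ψ x ∂ν - ∫ x, ψ x ∂μ) }) :
    Fstat f X μ ν = Hcost f X μ ν := by
  have hXc : IsCompact X := by
    rw [hX]; exact hΩbdd.isCompact_closure
  have hΩX : Ω ⊆ X := by rw [hX]; exact subset_closure
  have hXne : X.Nonempty := hΩne.mono hΩX
  obtain ⟨U, hU, hXU, hAB⟩ := hNC
  refine le_antisymm (F_le_H hA1 hA2 hXc) ?_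
  have hBF : sSup { c : ℝ≥0∞ | ∃ ψ : Ed d → ℝ, ContinuousOn ψ U ∧ IsViscSupersol f 1 ψ U ∧
      c = ENNReal.ofReal (∫ x, ψ x ∂ν - ∫ x, ψ x ∂μ) } ≤ Fstat f X μ ν := by
    refine sSup_le ?_
    rintro c ⟨ψ, h1, h2, rfl⟩
    exact B_le_F hd hA1 hA3 hXc hU hXU h1 h2 hμX hνX
  refine le_trans ?_ hBF
  rw [← hAB]
  set A := sSup { c : ℝ≥0∞ | ∃ ψ : Ed d → ℝ, (∃ C : ℝ, ∀ x ∈ X, |ψ x| ≤ C) ∧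
          UpperSemicontinuousOn ψ X ∧ ContinuousOn ψ Ω ∧ IsViscSupersol f 1 ψ Ω ∧
          c = ENNReal.ofReal (∫ x, ψ x ∂ν - ∫ x, ψ x ∂μ) } with hA
  by_cases ht : A = ⊤
  · rw [ht]; exact le_top
  rw [← ENNReal.ofReal_toReal ht]
  obtain ⟨γ, Θ, hγ, hΘ, hmass, e1, e2, e3⟩ := exists_plan hA1 hA2 hXc hμX hνX A.toReal
    ENNReal.toReal_nonneg (by
      intro φ
      have hB : ∀ x, |φ x| ≤ ‖φ‖ := fun x => φ.norm_coe_le_norm x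
      rw [← ENNReal.ofReal_le_iff_le_toReal ht, hA]
      refine le_sSup ⟨Qf f X φ ‖φ‖, ⟨‖φ‖, fun x hx => Qf_abs hXc hB hx⟩,
        Qf_usc.upperSemicontinuousOn _, ?_, ?_, rfl⟩
      · exact Qf_continuousOn hA1 hA3 hXc hB hΩopen hΩconv hΩX
      · exact Qf_visc hXc hB hΩopen hΩX)
  exact (H_le_of_plan hA1 hA2 hXc hXne hμX γ Θ e1 e2 e3).trans hmass
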